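/- arXiv:2304.03484 — 3 statements merged into one kernel-verified Lean document; each statement's English description precedes it below -/
import Mathlib

section
/- There is an absolute constant C > 0 such that for every natural number h and every polygonal domain P = P₀ \ ⋃_{i=1}^h interior(Pᵢ) in 𝒞(h), the geodesic diameter satisfies diam_g(P) ≤ C·(1 + √h)·diam₂(P). In particular, the distortion ϱ(P) = diam_g(P)/diam₂(P) is O(h^{1/2}). -/
open Set Metric ENNReal RealInnerProductSpace

noncomputable section

/-- The Euclidean plane. -/
abbrev Plane := EuclideanSpace ℝ (Fin 2)

/-- A convex polygon: the convex hull of a nonempty finite point set. -/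
def IsConvexPolygon (Q : Set Plane) : Prop :=
  ∃ S : Finset Plane, S.Nonempty ∧ Q = convexHull ℝ (S : Set Plane)

/-- `γ` is a continuous path from `s` to `t` (parametrized on `[0,1]`) with image in `P`. -/
def IsPathIn (P : Set Plane) (γ : ℝ → Plane) (s t : Plane) : Prop :=
  ContinuousOn γ (Set.Icc 0 1) ∧ γ 0 = s ∧ γ 1 = t ∧ Set.MapsTo γ (Set.Icc 0 1) P

/-- Length of a path: its total variation on `[0,1]`. -/
def pathLen (γ : ℝ → Plane) : ℝ≥0∞ := eVariationOn γ (Set.Icc 0 1)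

/-- Geodesic distance inside `P`: infimum of lengths of continuous paths
from `s` to `t` contained in `P`. -/
def geod (P : Set Plane) (s t : Plane) : ℝ≥0∞ :=
  ⨅ γ : {γ : ℝ → Plane // IsPathIn P γ s t}, pathLen γ.1

/-- Geodesic diameter of `P`. -/
def geodDiam (P : Set Plane) : ℝ≥0∞ :=
  ⨆ s ∈ P, ⨆ t ∈ P, geod P s t

/-- The width of a planar set: the minimum, over unit directions `v`,
of the extent of `C` in direction `v`. -/
def setWidth (C : Set Plane) : ℝ :=
  ⨅ v : {v : Plane // ‖v‖ = 1},
    (sSup ((fun x => ⟪x, v.1⟫) '' C) - sInf ((fun x => ⟪x, v.1⟫) '' C))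

theorem geod_le_pathLen {P : Set Plane} {s t : Plane} {γ : ℝ → Plane} (h : IsPathIn P γ s t) :
    geod P s t ≤ pathLen γ :=
  iInf_le (fun γ : {γ : ℝ → Plane // IsPathIn P γ s t} => pathLen γ.1) ⟨γ, h⟩

theorem geod_anti {A B : Set Plane} (h : A ⊆ B) (s t : Plane) : geod B s t ≤ geod A s t :=
  le_iInf fun γ => geod_le_pathLen
    ⟨γ.2.1, γ.2.2.1, γ.2.2.2.1, fun _ hx => h (γ.2.2.2.2 hx)⟩

/-- Concatenation of paths. -/
theorem IsPathIn.exists_concat {P : Set Plane} {s r t : Plane} {γ₁ γ₂ : ℝ → Plane}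
    (h₁ : IsPathIn P γ₁ s r) (h₂ : IsPathIn P γ₂ r t) :
    ∃ γ, IsPathIn P γ s t ∧ pathLen γ ≤ pathLen γ₁ + pathLen γ₂ := by
  obtain ⟨c₁, s₁, r₁, m₁⟩ := h₁
  obtain ⟨c₂, r₂, t₂, m₂⟩ := h₂
  set γ : ℝ → Plane := fun x => if x ≤ 1 / 2 then γ₁ (2 * x) else γ₂ (2 * x - 1) with hγ
  have e₁ : EqOn γ (γ₁ ∘ fun x => 2 * x) (Icc 0 (1 / 2)) := fun x hx => by
    simp only [hγ, Function.comp]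
    rw [if_pos hx.2]
  have e₂ : EqOn γ (γ₂ ∘ fun x => 2 * x - 1) (Icc (1 / 2) 1) := fun x hx => by
    simp only [hγ, Function.comp]
    split_ifs with h
    · have : x = 1 / 2 := le_antisymm h hx.1
      subst this
      norm_num [r₁, r₂]
    · rfl
  have k₁ : MapsTo (fun x : ℝ => 2 * x) (Icc 0 (1 / 2)) (Icc 0 1) := fun x hx =>
    ⟨by linarith [hx.1], by linarith [hx.2]⟩
  have k₂ : MapsTo (fun x : ℝ => 2 * x - 1) (Icc (1 / 2) 1) (Icc 0 1) := fun x hx =>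
    ⟨by linarith [hx.1], by linarith [hx.2]⟩
  have hu : Icc (0 : ℝ) 1 = Icc 0 (1 / 2) ∪ Icc (1 / 2) 1 :=
    (Icc_union_Icc_eq_Icc (by norm_num) (by norm_num)).symm
  refine ⟨γ, ⟨?_, ?_, ?_, ?_⟩, ?_⟩
  · rw [hu]
    refine ContinuousOn.union_of_isClosed ?_ ?_ isClosed_Icc isClosed_Icc
    · exact (c₁.comp (by fun_prop) k₁).congr e₁
    · exact (c₂.comp (by fun_prop) k₂).congr e₂
  · rw [e₁ ⟨le_rfl, by norm_num⟩]
    simpa using s₁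
  · rw [e₂ ⟨by norm_num, le_rfl⟩]
    norm_num [t₂]
  · rw [hu]
    rintro x (hx | hx)
    · rw [e₁ hx]
      exact m₁ (k₁ hx)
    · rw [e₂ hx]
      exact m₂ (k₂ hx)
  · unfold pathLen
    rw [hu, eVariationOn.union γ (isGreatest_Icc (by norm_num)) (isLeast_Icc (by norm_num)),
      eVariationOn.congr e₁, eVariationOn.congr e₂, ← hu]
    exact add_le_add
      (eVariationOn.comp_le_of_monotoneOn _ _ (fun x _ y _ h => by simpa using h) k₁)
      (eVariationOn.comp_le_of_monotoneOn _ _ (fun x _ y _ h => by simpa using h) k₂)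

theorem geod_triangle (P : Set Plane) (s r t : Plane) :
    geod P s t ≤ geod P s r + geod P r t := by
  conv_rhs => simp only [geod, ENNReal.iInf_add, ENNReal.add_iInf]
  refine le_iInf fun γ₁ => le_iInf fun γ₂ => ?_
  obtain ⟨γ, hγ, hl⟩ := γ₂.2.exists_concat γ₁.2
  exact (geod_le_pathLen hγ).trans hl

theorem geod_comm_le (P : Set Plane) (s t : Plane) : geod P s t ≤ geod P t s := by
  refine le_iInf fun γ => ?_
  obtain ⟨γ, c, h₀, h₁, m⟩ := γ
  have k : MapsTo (fun x : ℝ => 1 - x) (Icc 0 1) (Icc 0 1) := fun x hx =>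
    ⟨by linarith [hx.2], by linarith [hx.1]⟩
  have hp : IsPathIn P (γ ∘ fun x => 1 - x) s t :=
    ⟨c.comp (by fun_prop) k, by simpa using h₁, by simpa using h₀, m.comp k⟩
  exact (geod_le_pathLen hp).trans
    (eVariationOn.comp_le_of_antitoneOn _ _ (fun x _ y _ h => sub_le_sub_left h 1) k)

theorem geod_trans_le {P : Set Plane} {s r t : Plane} {a b : ℝ} (ha : 0 ≤ a) (hb : 0 ≤ b)
    (h₁ : geod P s r ≤ ENNReal.ofReal a) (h₂ : geod P r t ≤ ENNReal.ofReal b) :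
    geod P s t ≤ ENNReal.ofReal (a + b) := by
  rw [ENNReal.ofReal_add ha hb]
  exact (geod_triangle P s r t).trans (add_le_add h₁ h₂)

theorem geod_le_dist {P : Set Plane} {s t : Plane} (h : segment ℝ s t ⊆ P) :
    geod P s t ≤ ENNReal.ofReal (dist s t) := by
  have hp : IsPathIn P (AffineMap.lineMap s t) s t := by
    refine ⟨(AffineMap.lineMap_continuous).continuousOn, by simp, by simp, fun x hx => h ?_⟩
    rw [segment_eq_image_lineMap]
    exact mem_image_of_mem _ hx
  refine (geod_le_pathLen hp).trans ?_
  have := (lipschitzWith_lineMap (𝕜 := ℝ) s t).lipschitzOnWith (s := univ)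
    |>.comp_eVariationOn_le (g := (id : ℝ → ℝ)) (s := Icc 0 1) (mapsTo_univ _ _)
  refine this.trans ?_
  have h1 : eVariationOn (id : ℝ → ℝ) (Icc 0 1) ≤ 1 := by simp
  calc _ ≤ (nndist s t : ℝ≥0∞) * 1 := by gcongr
    _ = _ := by rw [mul_one, ← edist_nndist, edist_dist]

theorem geod_map_le {A B : Set Plane} {f : Plane → Plane} (hf : LipschitzWith 1 f)
    (hm : MapsTo f A B) (s t : Plane) : geod B (f s) (f t) ≤ geod A s t := by
  refine le_iInf fun γ => ?_
  obtain ⟨γ, c, h₀, h₁, m⟩ := γ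
  have hp : IsPathIn B (f ∘ γ) (f s) (f t) :=
    ⟨hf.continuous.comp_continuousOn c, by simp [h₀], by simp [h₁], hm.comp m⟩
  refine (geod_le_pathLen hp).trans ?_
  simpa [pathLen] using (hf.lipschitzOnWith (s := univ)).comp_eVariationOn_le (g := γ) (s := Icc 0 1)
    (mapsTo_univ _ _)

theorem exists_pos_add_smul_mem {K : Set Plane} {x : Plane} (hx : x ∈ interior K) (v : Plane) :
    ∃ ε : ℝ, 0 < ε ∧ x + ε • v ∈ K := by
  have hcont : ContinuousAt (fun ε : ℝ => x + ε • v) 0 := by fun_prop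
  have hev := hcont.preimage_mem_nhds (t := K) (by simpa using mem_interior_iff_mem_nhds.1 hx)
  obtain ⟨ε, hK, hε⟩ := (Filter.inter_mem (mem_nhdsWithin_of_mem_nhds hev)
    (self_mem_nhdsWithin (a := (0 : ℝ)) (s := Ioi 0)) |> Filter.nonempty_of_mem)
  exact ⟨ε, hε, hK⟩

/-- The nearest-point retraction onto a convex body: it is nonexpansive and sends the complement of
the interior to the boundary. -/
theorem exists_retraction {K : Set Plane} (hK : IsCompact K) (hc : Convex ℝ K)
    (hne : K.Nonempty) :
    ∃ f : Plane → Plane, LipschitzWith 1 f ∧ (∀ x ∈ K, f x = x) ∧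
      MapsTo f (interior K)ᶜ (K \ interior K) := by
  choose f hfK hf using exists_norm_eq_iInf_of_complete_convex hne hK.isComplete hc
  have hin : ∀ u, ∀ w ∈ K, inner ℝ (u - f u) (w - f u) ≤ 0 := fun u =>
    (norm_eq_iInf_iff_real_inner_le_zero hc (hfK u)).1 (hf u)
  have hfix : ∀ x ∈ K, f x = x := fun x hx => by
    have := hin x x hx
    rw [real_inner_self_nonpos, sub_eq_zero] at this
    exact this.symm
  refine ⟨f, LipschitzWith.of_dist_le_mul fun x y => ?_, hfix, fun x hx => ⟨hfK x, fun hi => ?_⟩⟩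
  · rw [NNReal.coe_one, one_mul, dist_eq_norm, dist_eq_norm]
    have h1 := hin x (f y) (hfK y)
    have h2 := hin y (f x) (hfK x)
    have h3 : ‖f x - f y‖ * ‖f x - f y‖ ≤ inner ℝ (x - y) (f x - f y) := by
      rw [← real_inner_self_eq_norm_mul_norm]
      simp only [inner_sub_left, inner_sub_right] at h1 h2 ⊢
      have c1 := real_inner_comm (f x) (f y)
      linarith
    have h4 := h3.trans (real_inner_le_norm _ _)
    by_contra! h
    nlinarith [norm_nonneg (f x - f y), norm_nonneg (x - y)]
  · have hne : x ≠ f x := fun h => hx (h ▸ hi)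
    obtain ⟨ε, hε', hεK⟩ := exists_pos_add_smul_mem hi (x - f x)
    have := hin x _ hεK
    rw [add_sub_cancel_left, inner_smul_right] at this
    have h0 : 0 < inner ℝ (x - f x) (x - f x) := real_inner_self_pos.2 (sub_ne_zero.2 hne)
    nlinarith [mul_pos hε' h0]

/-- An orthonormal frame of the plane; `ey` is thought of as the upward direction. -/
structure Frame where
  ex : Plane
  ey : Plane
  norm_ex : ‖ex‖ = 1
  norm_ey : ‖ey‖ = 1
  inner_ex_ey : inner ℝ ex ey = 0
  repr : ∀ v : Plane, v = (inner ℝ ex v) • ex + (inner ℝ ey v) • ey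

namespace Frame

/-- Horizontal coordinate. -/
def X (F : Frame) : Plane →L[ℝ] ℝ := innerSL ℝ F.ex

/-- Vertical coordinate. -/
def Y (F : Frame) : Plane →L[ℝ] ℝ := innerSL ℝ F.ey

variable (F : Frame)

@[simp] theorem X_ex : F.X F.ex = 1 := by simp [X, F.norm_ex]
@[simp] theorem Y_ey : F.Y F.ey = 1 := by simp [Y, F.norm_ey]
@[simp] theorem X_ey : F.X F.ey = 0 := F.inner_ex_ey
@[simp] theorem Y_ex : F.Y F.ex = 0 := (real_inner_comm _ _).trans F.inner_ex_ey

theorem eq_add (v : Plane) : v = F.X v • F.ex + F.Y v • F.ey := F.repr v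

theorem abs_X_le (v : Plane) : |F.X v| ≤ ‖v‖ := by
  simpa [X, F.norm_ex] using abs_real_inner_le_norm F.ex v

theorem abs_Y_le (v : Plane) : |F.Y v| ≤ ‖v‖ := by
  simpa [Y, F.norm_ey] using abs_real_inner_le_norm F.ey v

theorem ext_coord {u v : Plane} (hX : F.X u = F.X v) (hY : F.Y u = F.Y v) : u = v := by
  rw [F.eq_add u, F.eq_add v, hX, hY]

theorem dist_eq_of_X_eq {u v : Plane} (h : F.X u = F.X v) : dist u v = |F.Y u - F.Y v| := by
  rw [dist_eq_norm, F.eq_add (u - v)]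
  simp [h, norm_smul, F.norm_ey]

theorem dist_eq_of_Y_eq {u v : Plane} (h : F.Y u = F.Y v) : dist u v = |F.X u - F.X v| := by
  rw [dist_eq_norm, F.eq_add (u - v)]
  simp [h, norm_smul, F.norm_ex]

/-- The mirror image of a frame in its vertical axis. -/
def flip : Frame where
  ex := -F.ex
  ey := F.ey
  norm_ex := by simp [F.norm_ex]
  norm_ey := F.norm_ey
  inner_ex_ey := by simp [F.inner_ex_ey]
  repr v := by simpa using F.repr v

@[simp] theorem flip_X (v : Plane) : F.flip.X v = -F.X v := by simp [flip, X]
@[simp] theorem flip_Y (v : Plane) : F.flip.Y v = F.Y v := rfl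

/-- The standard frame rotated by the angle `φ`. -/
def rot (φ : ℝ) : Frame where
  ex := !₂[Real.cos φ, Real.sin φ]
  ey := !₂[-Real.sin φ, Real.cos φ]
  norm_ex := by simp [EuclideanSpace.norm_eq]
  norm_ey := by simp [EuclideanSpace.norm_eq]
  inner_ex_ey := by simp [PiLp.inner_apply, Fin.sum_univ_two]; ring
  repr v := by
    have h := Real.sin_sq_add_cos_sq φ
    ext i
    fin_cases i <;> simp [PiLp.inner_apply, Fin.sum_univ_two]
    · linear_combination (-v 0) * h
    · linear_combination (-v 1) * h

theorem rot_X (φ : ℝ) (v : Plane) : (rot φ).X v = Real.cos φ * v 0 + Real.sin φ * v 1 := by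
  simp [X, rot, PiLp.inner_apply, Fin.sum_univ_two]; ring

theorem rot_Y (φ : ℝ) (v : Plane) : (rot φ).Y v = -Real.sin φ * v 0 + Real.cos φ * v 1 := by
  simp [Y, rot, PiLp.inner_apply, Fin.sum_univ_two]; ring

theorem rot_sub_Y (φ θ : ℝ) (v : Plane) :
    (rot (φ - θ)).Y v = Real.cos θ * (rot φ).Y v + Real.sin θ * (rot φ).X v := by
  simp only [rot_X, rot_Y, Real.sin_sub, Real.cos_sub]; ring

theorem rot_add_Y (φ θ : ℝ) (v : Plane) :
    (rot (φ + θ)).Y v = Real.cos θ * (rot φ).Y v - Real.sin θ * (rot φ).X v := by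
  simp only [rot_X, rot_Y, Real.sin_add, Real.cos_add]; ring

theorem rot_X_sub_le (φ ψ : ℝ) (v : Plane) :
    (rot φ).X v - (rot ψ).X v ≤ 2 * |φ - ψ| * ‖v‖ := by
  have hc := Real.abs_cos_sub_cos_le φ ψ
  have hs := Real.abs_sin_sub_sin_le φ ψ
  have h0 : |v 0| ≤ ‖v‖ := PiLp.norm_apply_le v 0
  have h1 : |v 1| ≤ ‖v‖ := PiLp.norm_apply_le v 1
  calc _ = (Real.cos φ - Real.cos ψ) * v 0 + (Real.sin φ - Real.sin ψ) * v 1 := by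
        simp only [rot_X]; ring
    _ ≤ |Real.cos φ - Real.cos ψ| * |v 0| + |Real.sin φ - Real.sin ψ| * |v 1| :=
        add_le_add ((le_abs_self _).trans (abs_mul _ _).le) ((le_abs_self _).trans (abs_mul _ _).le)
    _ ≤ |φ - ψ| * ‖v‖ + |φ - ψ| * ‖v‖ := by gcongr
    _ = _ := by ring

end Frame

theorem exists_lt_of_mem_interior {K : Set Plane} {x v : Plane} (hx : x ∈ interior K)
    (f : Plane →L[ℝ] ℝ) (hf : f v < 0) : ∃ q ∈ K, f q < f x := by
  obtain ⟨ε, hε, h⟩ := exists_pos_add_smul_mem hx v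
  exact ⟨_, h, by simpa using mul_neg_of_pos_of_neg hε hf⟩

theorem exists_lexMin {K : Set Plane} (hK : IsCompact K) (hne : K.Nonempty) {f g : Plane → ℝ}
    (hf : Continuous f) (hg : Continuous g) :
    ∃ m ∈ K, (∀ q ∈ K, f m ≤ f q) ∧ ∀ q ∈ K, f q = f m → g m ≤ g q := by
  obtain ⟨m₀, h₀, hm₀⟩ := hK.exists_isMinOn hne hf.continuousOn
  obtain ⟨m, ⟨hmK, hm⟩, hmin⟩ := (hK.inter_right (isClosed_eq hf continuous_const)).exists_isMinOn
    (s := K ∩ {q | f q = f m₀}) ⟨m₀, h₀, rfl⟩ hg.continuousOn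
  have hm : f m = f m₀ := hm
  exact ⟨m, hmK, fun q hq => hm ▸ hm₀ hq, fun q hq h => hmin ⟨hq, h.trans hm⟩⟩

namespace Frame

variable (F : Frame)

/-- `p` is the lowest point of `K` on its vertical line. -/
def Lowest (K : Set Plane) (p : Plane) : Prop :=
  p ∈ K ∧ ∀ q ∈ K, F.X q = F.X p → F.Y p ≤ F.Y q

variable {F} {K : Set Plane} {p : Plane}

theorem Lowest.flip (h : F.Lowest K p) : F.flip.Lowest K p :=
  ⟨h.1, fun q hq e => h.2 q hq (by simpa using e)⟩

theorem exists_lower_of_mem_interior {r : Plane} (hr : r ∈ interior K) :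
    ∃ q ∈ K, F.X q = F.X r ∧ F.Y q < F.Y r := by
  obtain ⟨ε, hε, h⟩ := exists_pos_add_smul_mem hr (-F.ey)
  exact ⟨_, h, by simp, by simpa using hε⟩

/-- A lowest point lies below every chord. -/
theorem Lowest.le_chord (h : F.Lowest K p) (hc : Convex ℝ K) {q₁ q₂ : Plane} (h₁ : q₁ ∈ K)
    (h₂ : q₂ ∈ K) (hl : F.X q₁ ≤ F.X p) (hr : F.X p ≤ F.X q₂) :
    (F.X q₂ - F.X q₁) * F.Y p ≤
      (F.X q₂ - F.X p) * F.Y q₁ + (F.X p - F.X q₁) * F.Y q₂ := by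
  rcases (hl.trans hr).eq_or_lt with e | hlt
  · have e₁ : F.X p = F.X q₁ := le_antisymm (e ▸ hr) hl
    simp [← e, e₁]
  have hd : 0 < F.X q₂ - F.X q₁ := sub_pos.2 hlt
  have hq : ((F.X q₂ - F.X p) / (F.X q₂ - F.X q₁)) • q₁ +
      ((F.X p - F.X q₁) / (F.X q₂ - F.X q₁)) • q₂ ∈ K :=
    hc h₁ h₂ (div_nonneg (sub_nonneg.2 hr) hd.le) (div_nonneg (sub_nonneg.2 hl) hd.le)
      (by field_simp; ring)
  have := h.2 _ hq (by simp; field_simp; ring)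
  simp only [map_add, map_smul, smul_eq_mul] at this
  calc _ ≤ (F.X q₂ - F.X q₁) * _ := mul_le_mul_of_nonneg_left this hd.le
    _ = _ := by field_simp

variable {m a z : Plane}

theorem Lowest.Y_le_leftmost (h : F.Lowest K p) (hc : Convex ℝ K) (hm : m ∈ K)
    (hmY : ∀ q ∈ K, F.Y m ≤ F.Y q) (hpm : F.X p ≤ F.X m) (ha : a ∈ K)
    (haX : ∀ q ∈ K, F.X a ≤ F.X q) : F.Y p ≤ F.Y a := by
  have hap := haX p h.1
  have hch := h.le_chord hc ha hm hap hpm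
  have hma := hmY a ha
  rcases (hap.trans hpm).eq_or_lt with e | hlt
  · exact h.2 a ha (le_antisymm hap (e ▸ hpm))
  · nlinarith

/-- Sliding along the boundary of a convex body from the left part of its lower boundary to its
leftmost point. -/
theorem Lowest.geod_leftmost_le (h : F.Lowest K p) (hK : IsCompact K) (hc : Convex ℝ K)
    (hm : m ∈ K) (hmY : ∀ q ∈ K, F.Y m ≤ F.Y q) (hpm : F.X p ≤ F.X m) (ha : a ∈ K)
    (haX : ∀ q ∈ K, F.X a ≤ F.X q) :
    geod (K \ interior K) p a ≤ ENNReal.ofReal (F.X p - F.X a + (F.Y a - F.Y p)) := by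
  have hap := haX p h.1
  have hpa := h.Y_le_leftmost hc hm hmY hpm ha haX
  obtain ⟨f, hf, hfix, hmaps⟩ := exists_retraction hK hc ⟨p, h.1⟩
  rw [← hfix p h.1, ← hfix a ha]
  refine (geod_map_le hf hmaps p a).trans ?_
  rw [hfix p h.1, hfix a ha]
  set c : Plane := p + (F.X a - F.X p) • F.ex with hcdef
  have hcX : F.X c = F.X a := by simp [hcdef]
  have hcY : F.Y c = F.Y p := by simp [hcdef]
  refine geod_trans_le (r := c) (sub_nonneg.2 hap) (sub_nonneg.2 hpa) ?_ ?_
  · refine (geod_le_dist ?_).trans_eq ?_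
    · intro r hr hri
      obtain ⟨u, v, hu, hv, huv, rfl⟩ := hr
      have hY : F.Y (u • p + v • c) = F.Y p := by
        simp [hcY, ← add_mul, huv]
      have hX : F.X (u • p + v • c) ≤ F.X p := by
        simp only [map_add, map_smul, smul_eq_mul, hcX]
        have h1 := mul_le_mul_of_nonneg_left hap hv
        have h2 : u * F.X p + v * F.X p = F.X p := by rw [← add_mul, huv, one_mul]
        linarith
      set r := u • p + v • c
      obtain ⟨q, hq, hqX, hqY⟩ := exists_lower_of_mem_interior (F := F) hri
      rcases hpm.eq_or_lt with e | hlt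
      · have h1 := h.2 m hm e.symm
        have h2 := hmY q hq
        linarith
      · have h1 := h.le_chord hc hq hm (by linarith) hpm
        have h2 := hmY p h.1
        nlinarith
    · rw [F.dist_eq_of_Y_eq hcY.symm, hcX, abs_of_nonneg (sub_nonneg.2 hap)]
  · refine (geod_le_dist ?_).trans_eq ?_
    · intro r hr hri
      obtain ⟨u, v, hu, hv, huv, rfl⟩ := hr
      obtain ⟨q, hq, hlt⟩ := exists_lt_of_mem_interior hri F.X (v := -F.ex) (by simp)
      have := haX q hq
      simp only [map_add, map_smul, smul_eq_mul, hcX, ← add_mul, huv, one_mul] at hlt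
      linarith
    · rw [F.dist_eq_of_X_eq hcX, hcY, abs_sub_comm, abs_of_nonneg (sub_nonneg.2 hpa)]

theorem X_le_of_tilted_min {c s : ℝ} (hc0 : 0 < c) (hs0 : 0 < s) (hm : m ∈ K)
    (hz : z ∈ K) (hmY : ∀ q ∈ K, F.Y m ≤ F.Y q)
    (hzY : ∀ q ∈ K, c * F.Y z + s * F.X z ≤ c * F.Y q + s * F.X q) : F.X z ≤ F.X m := by
  have h1 := hmY z hz
  have h2 := hzY m hm
  have : s * F.X z ≤ s * F.X m := by nlinarith
  exact le_of_mul_le_mul_left this hs0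

/-- The horizontal displacement of a slide is controlled by the vertical one, up to the width of
the part of the lower boundary whose slope is small. -/
theorem Lowest.X_sub_leftmost_le {c s N : ℝ} (hc0 : 0 < c) (hs0 : 0 < s) (hN : c ≤ N * s)
    (h : F.Lowest K p) (hc : Convex ℝ K) (hm : m ∈ K) (hmY : ∀ q ∈ K, F.Y m ≤ F.Y q)
    (hpm : F.X p ≤ F.X m) (ha : a ∈ K) (haX : ∀ q ∈ K, F.X a ≤ F.X q) (hz : z ∈ K)
    (hzY : ∀ q ∈ K, c * F.Y z + s * F.X z ≤ c * F.Y q + s * F.X q) :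
    F.X p - F.X a ≤ F.X m - F.X z + N * (F.Y a - F.Y p) := by
  have hap := haX p h.1
  have hpa := h.Y_le_leftmost hc hm hmY hpm ha haX
  have hzm := X_le_of_tilted_min hc0 hs0 hm hz hmY hzY
  have hza := hzY a ha
  have haz := haX z hz
  rcases le_or_gt (F.X p) (F.X z) with hpz | hzp
  · have hch := h.le_chord hc ha hz hap hpz
    have hg : c * F.Y p + s * F.X p ≤ c * F.Y a + s * F.X a := by
      rcases haz.eq_or_lt with e | hlt
      · have e' : F.X p = F.X a := le_antisymm (e ▸ hpz) hap
        rw [e']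
        nlinarith
      · have hd : 0 < F.X z - F.X a := sub_pos.2 hlt
        refine le_of_mul_le_mul_left ?_ hd
        nlinarith [mul_le_mul_of_nonneg_left hch hc0.le,
          mul_le_mul_of_nonneg_left hza (sub_nonneg.2 hap)]
    have : s * (F.X p - F.X a) ≤ s * (N * (F.Y a - F.Y p)) := by
      nlinarith [mul_le_mul_of_nonneg_right hN (sub_nonneg.2 hpa)]
    linarith [le_of_mul_le_mul_left this hs0]
  · have hch := h.le_chord hc hz hm hzp.le hpm
    have hYz : F.Y p ≤ F.Y z := by
      have := hmY z hz
      have hd : 0 < F.X m - F.X z := by linarith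
      refine le_of_mul_le_mul_left ?_ hd
      nlinarith
    have hYa : F.Y z ≤ F.Y a := by nlinarith
    have hN0 : 0 ≤ N := by
      by_contra! hN'
      nlinarith
    have : s * (F.X z - F.X a) ≤ s * (N * (F.Y a - F.Y z)) := by
      nlinarith [mul_le_mul_of_nonneg_right hN (sub_nonneg.2 hYa)]
    have h3 := le_of_mul_le_mul_left this hs0
    have h4 : N * (F.Y a - F.Y z) ≤ N * (F.Y a - F.Y p) := by gcongr
    linarith

variable {b z' : Plane}

/-- From a lower boundary point one can slide to the left or to the right extreme point, without
losing height. -/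
theorem Lowest.slide {c s N : ℝ} (hc0 : 0 < c) (hs0 : 0 < s) (hN : c ≤ N * s)
    (h : F.Lowest K p) (hK : IsCompact K) (hc : Convex ℝ K) (hm : m ∈ K)
    (hmY : ∀ q ∈ K, F.Y m ≤ F.Y q) (hmX : ∀ q ∈ K, F.Y q = F.Y m → F.X m ≤ F.X q)
    (ha : a ∈ K) (haX : ∀ q ∈ K, F.X a ≤ F.X q) (hb : b ∈ K) (hbX : ∀ q ∈ K, F.X q ≤ F.X b)
    (hz : z ∈ K) (hzY : ∀ q ∈ K, c * F.Y z + s * F.X z ≤ c * F.Y q + s * F.X q)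
    (hz' : z' ∈ K) (hzY' : ∀ q ∈ K, c * F.Y z' - s * F.X z' ≤ c * F.Y q - s * F.X q)
    (hap : F.X a < F.X p) :
    (F.Y p < F.Y a ∧ geod (K \ interior K) p a ≤
      ENNReal.ofReal (F.X z' - F.X z + (N + 1) * (F.Y a - F.Y p))) ∨
    (F.Y p ≤ F.Y b ∧ geod (K \ interior K) p b ≤
      ENNReal.ofReal (F.X z' - F.X z + (N + 1) * (F.Y b - F.Y p))) := by
  have hzm := X_le_of_tilted_min hc0 hs0 hm hz hmY hzY
  have hzY'' : ∀ q ∈ K, c * F.flip.Y z' + s * F.flip.X z' ≤ c * F.flip.Y q + s * F.flip.X q := by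
    simpa [← sub_eq_add_neg] using hzY'
  have hmz := X_le_of_tilted_min (F := F.flip) hc0 hs0 hm hz' hmY hzY''
  rw [flip_X, flip_X, neg_le_neg_iff] at hmz
  rcases lt_or_ge (F.X p) (F.X m) with hpm | hmp
  · left
    constructor
    · have hma : F.Y m < F.Y a := by
        refine (hmY a ha).lt_of_ne fun e => ?_
        linarith [hmX a ha e.symm]
      have hch := h.le_chord hc ha hm hap.le hpm.le
      have hd : 0 < F.X m - F.X a := by linarith
      refine lt_of_mul_lt_mul_left ?_ hd.le
      nlinarith
    · refine (h.geod_leftmost_le hK hc hm hmY hpm.le ha haX).trans (ENNReal.ofReal_le_ofReal ?_)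
      linarith [h.X_sub_leftmost_le hc0 hs0 hN hc hm hmY hpm.le ha haX hz hzY]
  · right
    have hbX' : ∀ q ∈ K, F.flip.X b ≤ F.flip.X q := by simpa using hbX
    have hpm' : F.flip.X p ≤ F.flip.X m := by simpa using hmp
    refine ⟨h.flip.Y_le_leftmost hc hm hmY hpm' hb hbX', ?_⟩
    refine (h.flip.geod_leftmost_le hK hc hm hmY hpm' hb hbX').trans
      (ENNReal.ofReal_le_ofReal ?_)
    have := h.flip.X_sub_leftmost_le hc0 hs0 hN hc hm hmY hpm' hb hbX' hz' hzY''
    simp only [flip_X, flip_Y] at this ⊢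
    linarith

end Frame

namespace Frame

variable {F : Frame}

theorem coord_mem_segment {s p r : Plane} (h : r ∈ segment ℝ s p) (hX : F.X p = F.X s)
    (hY : F.Y s ≤ F.Y p) : F.X r = F.X s ∧ F.Y s ≤ F.Y r ∧ F.Y r ≤ F.Y p := by
  obtain ⟨u, v, hu, hv, huv, rfl⟩ := h
  obtain rfl : u = 1 - v := by linarith
  simp only [map_add, map_smul, smul_eq_mul, hX]
  refine ⟨by ring, ?_, ?_⟩ <;> nlinarith

theorem exists_lowest {K : Set Plane} (hK : IsCompact K) {q : Plane} (hq : q ∈ K) :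
    ∃ p, F.Lowest K p ∧ F.X p = F.X q := by
  obtain ⟨p, ⟨hpK, hp⟩, hmin⟩ := (hK.inter_right
    (isClosed_eq F.X.continuous continuous_const)).exists_isMinOn
    (s := K ∩ {r | F.X r = F.X q}) ⟨q, hq, rfl⟩ F.Y.continuous.continuousOn
  have hp : F.X p = F.X q := hp
  exact ⟨p, ⟨hpK, fun r hr e => hmin ⟨hr, e.trans hp⟩⟩, hp⟩

theorem exists_highest {K : Set Plane} (hK : IsCompact K) {q : Plane} (hq : q ∈ K) :
    ∃ p ∈ K, F.X p = F.X q ∧ ∀ r ∈ K, F.X r = F.X q → F.Y r ≤ F.Y p := by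
  obtain ⟨p, ⟨hpK, hp⟩, hmax⟩ := (hK.inter_right
    (isClosed_eq F.X.continuous continuous_const)).exists_isMaxOn
    (s := K ∩ {r | F.X r = F.X q}) ⟨q, hq, rfl⟩ F.Y.continuous.continuousOn
  exact ⟨p, hpK, hp, fun r hr e => hmax ⟨hr, e⟩⟩

variable {ι : Type*} {P₀ : Set Plane} {Q : ι → Set Plane}

/-- The first hole met by a vertical ray. -/
theorem exists_first_hit [Finite ι] (hP₀c : Convex ℝ P₀) (hQ : ∀ i, IsCompact (Q i))
    (hQc : ∀ i, Convex ℝ (Q i)) (hQP : ∀ i, Q i ⊆ P₀) {s : Plane}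
    (hs : s ∈ P₀ \ ⋃ i, interior (Q i))
    (hhit : ∃ i, ∃ q ∈ interior (Q i), F.X q = F.X s ∧ F.Y s ≤ F.Y q) :
    ∃ i, ∃ p, F.Lowest (Q i) p ∧ (∃ q ∈ interior (Q i), F.X q = F.X p) ∧ F.X p = F.X s ∧
      F.Y s ≤ F.Y p ∧ segment ℝ s p ⊆ P₀ \ ⋃ i, interior (Q i) := by
  have hlow : ∀ i : {i // ∃ q ∈ interior (Q i), F.X q = F.X s ∧ F.Y s ≤ F.Y q},
      ∃ p, F.Lowest (Q i) p ∧ F.X p = F.X s := fun ⟨i, q, hq, hqX, _⟩ => by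
    obtain ⟨p, hp, hpX⟩ := exists_lowest (F := F) (hQ i) (interior_subset hq)
    exact ⟨p, hp, hpX.trans hqX⟩
  choose p hp hpX using hlow
  obtain ⟨i₀, hi₀⟩ := hhit
  have : Nonempty {i // ∃ q ∈ interior (Q i), F.X q = F.X s ∧ F.Y s ≤ F.Y q} := ⟨⟨i₀, hi₀⟩⟩
  obtain ⟨i, hi⟩ := Finite.exists_min fun i => F.Y (p i)
  obtain ⟨q, hq, hqX, hqY⟩ := i.2
  have hsp : F.Y s ≤ F.Y (p i) := by
    by_contra! hlt
    refine hs.2 (mem_iUnion.2 ⟨i, ?_⟩)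
    have hd : 0 < F.Y q - F.Y (p i) := by linarith
    have e : ((F.Y q - F.Y s) / (F.Y q - F.Y (p i))) • p i +
        ((F.Y s - F.Y (p i)) / (F.Y q - F.Y (p i))) • q = s := by
      apply F.ext_coord
      · simp only [map_add, map_smul, smul_eq_mul, hpX, hqX]
        field_simp
        ring
      · simp only [map_add, map_smul, smul_eq_mul]
        field_simp
        ring
    have hmem := (hQc i).combo_closure_interior_mem_interior (subset_closure (hp i).1) hq
      (div_nonneg (sub_nonneg.2 hqY) hd.le) (div_pos (sub_pos.2 hlt) hd) (by field_simp; ring)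
    rwa [e] at hmem
  refine ⟨i, p i, hp i, ⟨q, hq, hqX.trans (hpX i).symm⟩, hpX i, hsp, fun r hr => ⟨?_, ?_⟩⟩
  · exact hP₀c.segment_subset hs.1 (hQP i (hp i).1) hr
  · intro hr'
    obtain ⟨j, hj⟩ := mem_iUnion.1 hr'
    obtain ⟨hrX, hrs, hrp⟩ := coord_mem_segment hr (hpX i) hsp
    obtain ⟨r', hr', hrX', hrY'⟩ := exists_lower_of_mem_interior (F := F) hj
    have h1 := hi ⟨j, r, hj, hrX, hrs⟩
    have h2 := (hp ⟨j, r, hj, hrX, hrs⟩).2 r' hr' ((hrX'.trans hrX).trans (hpX _).symm)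
    linarith

/-- The lexicographic height of a point. -/
def key (F : Frame) (q : Plane) : ℝ ×ₗ ℝ := toLex (F.Y q, F.X q)

theorem key_le_key {p q : Plane} (hY : F.Y p ≤ F.Y q) (hX : F.X p ≤ F.X q) :
    F.key p ≤ F.key q := by
  rw [key, key, Prod.Lex.toLex_le_toLex]
  rcases hY.lt_or_eq with h | h
  · exact Or.inl h
  · exact Or.inr ⟨h, hX⟩

theorem key_lt_key {p q : Plane} (h : F.Y p < F.Y q ∨ F.Y p ≤ F.Y q ∧ F.X p < F.X q) :
    F.key p < F.key q := by
  rw [key, key, Prod.Lex.toLex_lt_toLex]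
  rcases h with h | ⟨h, hX⟩
  · exact Or.inl h
  · exact h.lt_or_eq.imp id fun e => ⟨e, hX⟩

/-- Climbing from a point of a domain with holes to the top of the domain: every hole met is
circumvented by sliding to one of its two extreme points, and each extreme point is used at most
once. -/
theorem exists_climb [Fintype ι] (hP₀ : IsCompact P₀) (hP₀c : Convex ℝ P₀)
    (hQ : ∀ i, IsCompact (Q i)) (hQc : ∀ i, Convex ℝ (Q i)) (hQP : ∀ i, Q i ⊆ P₀)
    (hbd : ∀ i, Q i \ interior (Q i) ⊆ P₀ \ ⋃ i, interior (Q i))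
    (exitPt : ι × Bool → Plane) (hexitPt : ∀ e, exitPt e ∈ P₀ \ ⋃ i, interior (Q i))
    (T : ι → ℝ) (hT : ∀ i, 0 ≤ T i) {L : ℝ} (hL : 1 ≤ L)
    (hslide : ∀ i p, F.Lowest (Q i) p → (∃ q ∈ interior (Q i), F.X q = F.X p) → ∃ σ,
      F.key p < F.key (exitPt (i, σ)) ∧ F.Y p ≤ F.Y (exitPt (i, σ)) ∧
      geod (Q i \ interior (Q i)) p (exitPt (i, σ)) ≤
        ENNReal.ofReal (T i + L * (F.Y (exitPt (i, σ)) - F.Y p)))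
    (s : Plane) (hs : s ∈ P₀ \ ⋃ i, interior (Q i)) :
    ∃ u ∈ P₀ \ ⋃ i, interior (Q i), (∀ q ∈ P₀, F.X q = F.X u → F.Y q ≤ F.Y u) ∧ F.Y s ≤ F.Y u ∧
      geod (P₀ \ ⋃ i, interior (Q i)) s u ≤ ENNReal.ofReal (L * (F.Y u - F.Y s) +
        ∑ e : ι × Bool with F.key s < F.key (exitPt e), T e.1) := by
  classical
  induction hn : Finset.card {e : ι × Bool | F.key s < F.key (exitPt e)}
    using Nat.strong_induction_on generalizing s with
  | _ n ih =>
  have hsum : ∀ s : Plane, 0 ≤ ∑ e : ι × Bool with F.key s < F.key (exitPt e), T e.1 :=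
    fun s => Finset.sum_nonneg fun e _ => hT e.1
  by_cases hhit : ∃ i, ∃ q ∈ interior (Q i), F.X q = F.X s ∧ F.Y s ≤ F.Y q
  · obtain ⟨i, p, hp, hq, hpX, hpY, hseg⟩ := exists_first_hit hP₀c hQ hQc hQP hs hhit
    obtain ⟨σ, hlt, hYle, hgeod⟩ := hslide i p hp hq
    have hkey : F.key s < F.key (exitPt (i, σ)) := (key_le_key hpY hpX.ge).trans_lt hlt
    have hsub : insert (i, σ) ({e : ι × Bool | F.key (exitPt (i, σ)) <
        F.key (exitPt e)} : Finset _) ⊆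
        ({e : ι × Bool | F.key s < F.key (exitPt e)} : Finset _) := by
      intro e he
      rcases Finset.mem_insert.1 he with rfl | he
      · simpa using hkey
      · simp only [Finset.mem_filter, Finset.mem_univ, true_and] at he ⊢
        exact hkey.trans he
    have hnot : (i, σ) ∉ ({e : ι × Bool | F.key (exitPt (i, σ)) < F.key (exitPt e)} : Finset _) := by
      simp
    have hcard := Finset.card_le_card hsub
    rw [Finset.card_insert_of_notMem hnot] at hcard
    obtain ⟨u, hu, htop, hYu, hgu⟩ := ih _ (by omega) (exitPt (i, σ)) (hexitPt _) rfl
    refine ⟨u, hu, htop, by linarith, ?_⟩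
    have hL0 : 0 ≤ L := by linarith
    have h1 : geod (P₀ \ ⋃ i, interior (Q i)) s p ≤
        ENNReal.ofReal (L * (F.Y p - F.Y s)) := by
      refine (geod_le_dist hseg).trans (ENNReal.ofReal_le_ofReal ?_)
      rw [F.dist_eq_of_X_eq hpX.symm, abs_sub_comm, abs_of_nonneg (sub_nonneg.2 hpY)]
      exact le_mul_of_one_le_left (sub_nonneg.2 hpY) hL
    have n1 := mul_nonneg hL0 (sub_nonneg.2 hpY)
    have n2 := add_nonneg (hT i) (mul_nonneg hL0 (sub_nonneg.2 hYle))
    have n3 := add_nonneg (mul_nonneg hL0 (sub_nonneg.2 hYu)) (hsum (exitPt (i, σ)))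
    have h2 := geod_trans_le (add_nonneg n1 n2) n3
      (geod_trans_le n1 n2 h1 ((geod_anti (hbd i) _ _).trans hgeod)) hgu
    refine h2.trans (ENNReal.ofReal_le_ofReal ?_)
    have h3 := Finset.sum_le_sum_of_subset_of_nonneg (f := fun e : ι × Bool => T e.1) hsub
      fun e _ _ => hT e.1
    rw [Finset.sum_insert hnot] at h3
    linarith
  · push Not at hhit
    obtain ⟨u, hu, huX, htop⟩ := exists_highest (F := F) hP₀ hs.1
    have hYu := htop s hs.1 rfl
    have hseg : segment ℝ s u ⊆ P₀ \ ⋃ i, interior (Q i) := fun r hr => by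
      refine ⟨hP₀c.segment_subset hs.1 hu hr, fun hr' => ?_⟩
      obtain ⟨j, hj⟩ := mem_iUnion.1 hr'
      obtain ⟨hrX, hrs, -⟩ := coord_mem_segment hr huX hYu
      exact (hhit j r hj hrX).not_ge hrs
    refine ⟨u, hseg (right_mem_segment ..), fun q hq e => htop q hq (e.trans huX), hYu, ?_⟩
    refine (geod_le_dist hseg).trans (ENNReal.ofReal_le_ofReal ?_)
    rw [F.dist_eq_of_X_eq huX.symm, abs_sub_comm, abs_of_nonneg (sub_nonneg.2 hYu)]
    have := le_mul_of_one_le_left (sub_nonneg.2 hYu) hL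
    linarith [hsum s]

/-- Two points on the upper boundary of a convex body are joined along its boundary. -/
theorem geod_top_le {K : Set Plane} (hK : IsCompact K) (hc : Convex ℝ K) {u v : Plane} {H : ℝ}
    (hH : ∀ q ∈ K, F.Y q ≤ H) (hu : u ∈ K) (hv : v ∈ K)
    (hut : ∀ q ∈ K, F.X q = F.X u → F.Y q ≤ F.Y u)
    (hvt : ∀ q ∈ K, F.X q = F.X v → F.Y q ≤ F.Y v) :
    geod (K \ interior K) u v ≤
      ENNReal.ofReal ((H - F.Y u) + |F.X u - F.X v| + (H - F.Y v)) := by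
  obtain ⟨f, hf, hfix, hmaps⟩ := exists_retraction hK hc ⟨u, hu⟩
  rw [← hfix u hu, ← hfix v hv]
  refine (geod_map_le hf hmaps u v).trans ?_
  rw [hfix u hu, hfix v hv]
  have hvert : ∀ w ∈ K, (∀ q ∈ K, F.X q = F.X w → F.Y q ≤ F.Y w) →
      geod (interior K)ᶜ w (w + (H - F.Y w) • F.ey) ≤ ENNReal.ofReal (H - F.Y w) := by
    intro w hw ht
    have hX : F.X (w + (H - F.Y w) • F.ey) = F.X w := by simp
    have hY : F.Y (w + (H - F.Y w) • F.ey) = H := by simp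
    refine (geod_le_dist ?_).trans_eq ?_
    · intro r hr hri
      obtain ⟨hrX, hrY, -⟩ := coord_mem_segment hr hX (by rw [hY]; exact hH w hw)
      obtain ⟨ε, hε, h⟩ := exists_pos_add_smul_mem hri F.ey
      have := ht _ h (by simpa using hrX)
      simp only [map_add, map_smul, smul_eq_mul, Y_ey, mul_one] at this
      linarith
    · rw [F.dist_eq_of_X_eq hX.symm, hY, abs_sub_comm, abs_of_nonneg (sub_nonneg.2 (hH w hw))]
  have hu0 := sub_nonneg.2 (hH u hu)
  have hv0 := sub_nonneg.2 (hH v hv)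
  refine geod_trans_le (add_nonneg hu0 (abs_nonneg _)) hv0
    (geod_trans_le hu0 (abs_nonneg _) (hvert u hu hut) ?_)
    ((geod_comm_le _ _ _).trans (hvert v hv hvt))
  refine (geod_le_dist ?_).trans_eq ?_
  · intro r hr hri
    obtain ⟨a, b, ha, hb, hab, rfl⟩ := hr
    obtain ⟨ε, hε, h⟩ := exists_pos_add_smul_mem hri F.ey
    have := hH _ h
    have e : F.Y (a • (u + (H - F.Y u) • F.ey) + b • (v + (H - F.Y v) • F.ey)) = H := by
      simp only [map_add, map_smul, smul_eq_mul, Y_ey, mul_one]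
      linear_combination H * hab
    rw [map_add, e] at this
    simp at this
    linarith
  · rw [F.dist_eq_of_Y_eq (by simp)]
    simp

end Frame

/-- The geodesic bound obtained by climbing in the direction of a fixed frame. Here `z' i` and `z i`
delimit the nearly horizontal part of the lower boundary of the hole `Q i`. -/
theorem geod_le_of_frame {ι : Type*} [Fintype ι] {P₀ : Set Plane} {Q : ι → Set Plane}
    (hP₀ : IsCompact P₀) (hP₀c : Convex ℝ P₀) (hQ : ∀ i, IsCompact (Q i))
    (hQc : ∀ i, Convex ℝ (Q i)) (hQn : ∀ i, (Q i).Nonempty) (hQP : ∀ i, Q i ⊆ P₀)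
    (hbd : ∀ i, Q i \ interior (Q i) ⊆ P₀ \ ⋃ i, interior (Q i))
    (hbd₀ : P₀ \ interior P₀ ⊆ P₀ \ ⋃ i, interior (Q i)) {D : ℝ}
    (hD : ∀ p ∈ P₀ \ ⋃ i, interior (Q i), ∀ q ∈ P₀ \ ⋃ i, interior (Q i), ‖p - q‖ ≤ D)
    (F : Frame) {c r N : ℝ} (hc0 : 0 < c) (hr0 : 0 < r) (hN0 : 0 ≤ N) (hN : c ≤ N * r)
    (m z z' : ι → Plane) (hm : ∀ i, m i ∈ Q i)
    (hmY : ∀ i, ∀ q ∈ Q i, F.Y (m i) ≤ F.Y q)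
    (hmX : ∀ i, ∀ q ∈ Q i, F.Y q = F.Y (m i) → F.X (m i) ≤ F.X q)
    (hz : ∀ i, z i ∈ Q i)
    (hzY : ∀ i, ∀ q ∈ Q i, c * F.Y (z i) + r * F.X (z i) ≤ c * F.Y q + r * F.X q)
    (hz' : ∀ i, z' i ∈ Q i)
    (hzY' : ∀ i, ∀ q ∈ Q i, c * F.Y (z' i) - r * F.X (z' i) ≤ c * F.Y q - r * F.X q)
    {s t : Plane} (hs : s ∈ P₀ \ ⋃ i, interior (Q i)) (ht : t ∈ P₀ \ ⋃ i, interior (Q i)) :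
    geod (P₀ \ ⋃ i, interior (Q i)) s t ≤ ENNReal.ofReal
      (2 * ((N + 1) * D + 2 * ∑ i, (F.X (z' i) - F.X (z i))) + 3 * D) := by
  choose a ha haX using fun i => (hQ i).exists_isMinOn (hQn i) F.X.continuous.continuousOn
  choose b hb hbX using fun i => (hQ i).exists_isMaxOn (hQn i) F.X.continuous.continuousOn
  have haX : ∀ i, ∀ q ∈ Q i, F.X (a i) ≤ F.X q := haX
  have hbX : ∀ i, ∀ q ∈ Q i, F.X q ≤ F.X (b i) := hbX
  have hT : ∀ i, 0 ≤ F.X (z' i) - F.X (z i) := fun i => by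
    have h1 := hzY i _ (hz' i)
    have h2 := hzY' i _ (hz i)
    refine sub_nonneg.2 (le_of_mul_le_mul_left ?_ hr0)
    linarith
  have hleft : ∀ i, ∀ q ∈ interior (Q i), F.X (a i) < F.X q := fun i q hq => by
    obtain ⟨q', hq', hlt⟩ := exists_lt_of_mem_interior hq F.X (v := -F.ex) (by simp)
    exact (haX i q' hq').trans_lt hlt
  have hright : ∀ i, ∀ q ∈ interior (Q i), F.X q < F.X (b i) := fun i q hq => by
    obtain ⟨q', hq', hlt⟩ := exists_lt_of_mem_interior hq (-F.X) (v := F.ex) (by simp)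
    exact (neg_lt_neg_iff.1 hlt).trans_le (hbX i q' hq')
  let exitPt : ι × Bool → Plane := fun e => bif e.2 then a e.1 else b e.1
  have hexitPt : ∀ e, exitPt e ∈ P₀ \ ⋃ i, interior (Q i) := by
    rintro ⟨i, _ | _⟩
    · exact hbd i ⟨hb i, fun h => (hright i _ h).false⟩
    · exact hbd i ⟨ha i, fun h => (hleft i _ h).false⟩
  have hclimb := F.exists_climb hP₀ hP₀c hQ hQc hQP hbd exitPt hexitPt
    (fun i => F.X (z' i) - F.X (z i)) hT (L := N + 1) (by linarith) fun i p hp ⟨q, hq, hqX⟩ => by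
      rcases hp.slide hc0 hr0 hN (hQ i) (hQc i) (hm i) (hmY i) (hmX i) (ha i) (haX i) (hb i)
        (hbX i) (hz i) (hzY i) (hz' i) (hzY' i) (hqX ▸ hleft i q hq) with ⟨h, hg⟩ | ⟨h, hg⟩
      · exact ⟨true, Frame.key_lt_key (Or.inl h), h.le, hg⟩
      · exact ⟨false, Frame.key_lt_key (Or.inr ⟨h, hqX ▸ hright i q hq⟩), h, hg⟩
  have hsum : ∀ s : Plane, ∑ e : ι × Bool with F.key s < F.key (exitPt e),
      (F.X (z' e.1) - F.X (z e.1)) ≤ 2 * ∑ i, (F.X (z' i) - F.X (z i)) := fun s => by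
    refine (Finset.sum_le_sum_of_subset_of_nonneg (Finset.filter_subset _ _)
      fun e _ _ => hT e.1).trans_eq ?_
    rw [Fintype.sum_prod_type, Finset.mul_sum]
    refine Finset.sum_congr rfl fun i _ => ?_
    rw [Fintype.sum_bool]
    ring
  have hclimb' : ∀ s ∈ P₀ \ ⋃ i, interior (Q i), ∃ u ∈ P₀ \ ⋃ i, interior (Q i),
      (∀ q ∈ P₀, F.X q = F.X u → F.Y q ≤ F.Y u) ∧ geod (P₀ \ ⋃ i, interior (Q i)) s u ≤
        ENNReal.ofReal ((N + 1) * D + 2 * ∑ i, (F.X (z' i) - F.X (z i))) := fun s hs => by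
    obtain ⟨u, hu, htop, -, hg⟩ := hclimb s hs
    refine ⟨u, hu, htop, hg.trans (ENNReal.ofReal_le_ofReal (add_le_add ?_ (hsum s)))⟩
    refine mul_le_mul_of_nonneg_left ?_ (by linarith)
    rw [← map_sub]
    exact ((le_abs_self _).trans (F.abs_Y_le _)).trans (hD u hu s hs)
  obtain ⟨u, hu, hut, hgu⟩ := hclimb' s hs
  obtain ⟨v, hv, hvt, hgv⟩ := hclimb' t ht
  obtain ⟨w, hw, hwY⟩ := hP₀.exists_isMaxOn ⟨s, hs.1⟩ F.Y.continuous.continuousOn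
  have hwP : w ∈ P₀ \ ⋃ i, interior (Q i) := hbd₀ ⟨hw, fun hwi => by
    obtain ⟨q, hq, hlt⟩ := exists_lt_of_mem_interior hwi (-F.Y) (v := F.ey) (by simp)
    exact (neg_lt_neg_iff.1 hlt).not_ge (hwY hq)⟩
  have hguv : geod (P₀ \ ⋃ i, interior (Q i)) u v ≤ ENNReal.ofReal (3 * D) := by
    refine (geod_anti hbd₀ u v).trans ((Frame.geod_top_le hP₀ hP₀c (fun q hq => hwY hq) hu.1 hv.1
      hut hvt).trans (ENNReal.ofReal_le_ofReal ?_))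
    have h1 := ((le_abs_self _).trans (F.abs_Y_le _)).trans (hD w hwP u hu)
    have h2 := ((le_abs_self _).trans (F.abs_Y_le _)).trans (hD w hwP v hv)
    have h3 := (F.abs_X_le _).trans (hD u hu v hv)
    rw [map_sub] at h1 h2 h3
    linarith
  have hD0 : 0 ≤ D := (norm_nonneg _).trans (hD s hs s hs)
  have hA : 0 ≤ (N + 1) * D + 2 * ∑ i, (F.X (z' i) - F.X (z i)) :=
    add_nonneg (by positivity) (mul_nonneg two_pos.le (Finset.sum_nonneg fun i _ => hT i))
  refine (geod_trans_le (by positivity) hA (geod_trans_le hA (by positivity) hgu hguv)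
    ((geod_comm_le _ _ _).trans hgv)).trans_eq ?_
  congr 1
  ring

/-- Summation by parts: the displacements of a bounded sequence of points, measured along a slowly
rotating direction, have a bounded sum. -/
theorem sum_rot_X_le {D θ : ℝ} (hθ : 0 ≤ θ) (z : ℕ → Plane) (hz : ∀ j k, ‖z j - z k‖ ≤ D)
    (n : ℕ) : ∑ j ∈ Finset.range n, ((Frame.rot ((j + 1 : ℕ) * θ)).X (z (j + 2)) -
      (Frame.rot ((j + 1 : ℕ) * θ)).X (z j)) ≤ 4 * D + n * (4 * θ * D) := by
  have key : ∑ j ∈ Finset.range n, ((Frame.rot ((j + 1 : ℕ) * θ)).X (z (j + 2)) -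
      (Frame.rot ((j + 1 : ℕ) * θ)).X (z j)) ≤
      (Frame.rot (n * θ)).X (z (n + 1) - z 0) + (Frame.rot (n * θ)).X (z n - z 0) + 2 * D +
        n * (4 * θ * D) := by
    induction n with
    | zero =>
      have h1 := (neg_le_abs _).trans (((Frame.rot ((0 : ℕ) * θ)).abs_X_le _).trans (hz (0 + 1) 0))
      have h2 := (norm_nonneg _).trans (hz 0 0)
      simp at h1 ⊢
      linarith
    | succ n ih =>
      rw [Finset.sum_range_succ]
      have hang : |(n : ℝ) * θ - ((n + 1 : ℕ) : ℝ) * θ| = θ := by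
        rw [← sub_mul]; simp [abs_of_nonneg hθ]
      have h1 := Frame.rot_X_sub_le (n * θ) ((n + 1 : ℕ) * θ) (z n - z 0)
      have h2 := Frame.rot_X_sub_le (n * θ) ((n + 1 : ℕ) * θ) (z (n + 1) - z 0)
      rw [hang] at h1 h2
      have h3 := mul_le_mul_of_nonneg_left (hz n 0) hθ
      have h4 := mul_le_mul_of_nonneg_left (hz (n + 1) 0) hθ
      simp only [map_sub, add_assoc, Nat.reduceAdd] at ih h1 h2 ⊢
      push_cast at ih h1 h2 ⊢
      linarith
  have h1 := (le_abs_self _).trans (((Frame.rot (n * θ)).abs_X_le _).trans (hz (n + 1) 0))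
  have h2 := (le_abs_self _).trans (((Frame.rot (n * θ)).abs_X_le _).trans (hz n 0))
  linarith

theorem cos_le_mul_sin_inv {N : ℝ} (hN : 1 ≤ N) : Real.cos N⁻¹ ≤ N * Real.sin N⁻¹ := by
  have h0 : 0 < N⁻¹ := by positivity
  have h1 : N⁻¹ < Real.pi / 2 := by linarith [inv_le_one_of_one_le₀ hN, Real.pi_gt_three]
  have hc := Real.cos_pos_of_mem_Ioo ⟨by linarith, h1⟩
  have h2 := (Real.lt_tan h0 h1).le
  rw [Real.tan_eq_sin_div_cos, le_div_iff₀ hc, inv_mul_le_iff₀ (by linarith)] at h2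
  exact h2

theorem IsConvexPolygon.isCompact {K : Set Plane} (h : IsConvexPolygon K) : IsCompact K := by
  obtain ⟨S, -, rfl⟩ := h
  exact S.finite_toSet.isCompact_convexHull ℝ

theorem IsConvexPolygon.convex {K : Set Plane} (h : IsConvexPolygon K) : Convex ℝ K := by
  obtain ⟨S, -, rfl⟩ := h
  exact convex_convexHull ℝ _

theorem IsConvexPolygon.nonempty {K : Set Plane} (h : IsConvexPolygon K) : K.Nonempty := by
  obtain ⟨S, hS, rfl⟩ := h
  exact (Finset.coe_nonempty.2 hS).convexHull

/-- Some direction sees small displacements of lowest points under a small rotation, on average over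
the holes. -/
theorem exists_frame_bound {ι : Type*} [Fintype ι] {D N : ℝ} {n : ℕ} (hn : 0 < n) (hN : N = n)
    (z : ι → ℝ → Plane) (hz : ∀ i φ ψ, ‖z i φ - z i ψ‖ ≤ D) :
    ∃ φ : ℝ, N * ∑ i, ((Frame.rot φ).X (z i (φ + N⁻¹)) - (Frame.rot φ).X (z i (φ - N⁻¹))) ≤
      Fintype.card ι * (8 * D) := by
  have hN0 : 0 < N := hN ▸ Nat.cast_pos.2 hn
  have hi : ∀ i, _ := fun i => sum_rot_X_le (θ := N⁻¹) (inv_nonneg.2 hN0.le)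
    (fun j => z i (j * N⁻¹)) (fun j k => hz i _ _) n
  have hle := Finset.sum_le_sum fun i (_ : i ∈ Finset.univ) => hi i
  rw [Finset.sum_comm] at hle
  have hc : (n : ℝ) * (4 * N⁻¹ * D) = 4 * D := by rw [← hN]; field_simp
  rw [hc, Finset.sum_const, Finset.card_univ, nsmul_eq_mul] at hle
  obtain ⟨j, -, hj⟩ := Finset.exists_le_of_sum_le (s := Finset.range n)
    (g := fun _ => N⁻¹ * (Fintype.card ι * (8 * D))) (Finset.nonempty_range_iff.2 hn.ne')
    (hle.trans_eq (by
      rw [Finset.sum_const, Finset.card_range, nsmul_eq_mul, ← hN]; field_simp; ring))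
  refine ⟨(j + 1 : ℕ) * N⁻¹, ?_⟩
  rw [← le_inv_mul_iff₀ hN0]
  convert hj using 7 <;> push_cast <;> ring

/-- There is an absolute constant `C > 0` such that for every `h ∈ ℕ` and
every polygonal domain `P = P₀ \ ⋃ᵢ interior Pᵢ` in `𝒞(h)`, we have
`diam_g(P) ≤ C·(1 + √h)·diam₂(P)`. -/
theorem geodesic_diameter_upper_bound :
    ∃ C : ℝ, 0 < C ∧
      ∀ (h : ℕ) (P₀ : Set Plane) (Q : Fin h → Set Plane),
        IsConvexPolygon P₀ →
        (∀ i, IsConvexPolygon (Q i)) →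
        Pairwise (Function.onFun Disjoint Q) →
        (∀ i, Q i ⊆ interior P₀) →
        geodDiam (P₀ \ ⋃ i, interior (Q i)) ≤
          ENNReal.ofReal
            (C * (1 + Real.sqrt h) * Metric.diam (P₀ \ ⋃ i, interior (Q i))) := by
  refine ⟨34, by norm_num, fun h P₀ Q hP₀ hQ hdisj hQP => ?_⟩
  set P := P₀ \ ⋃ i, interior (Q i) with hP
  have hbd : ∀ i, Q i \ interior (Q i) ⊆ P := fun i x hx => by
    refine ⟨interior_subset (hQP i hx.1), fun hx' => ?_⟩
    obtain ⟨j, hj⟩ := mem_iUnion.1 hx'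
    rcases eq_or_ne i j with rfl | hij
    · exact hx.2 hj
    · exact Set.disjoint_left.1 (hdisj hij) hx.1 (interior_subset hj)
  have hbd₀ : P₀ \ interior P₀ ⊆ P := fun x hx => ⟨hx.1, fun hx' => by
    obtain ⟨j, hj⟩ := mem_iUnion.1 hx'
    exact hx.2 (hQP j (interior_subset hj))⟩
  have hD : ∀ p ∈ P, ∀ q ∈ P, ‖p - q‖ ≤ Metric.diam P := fun p hp q hq =>
    (dist_eq_norm p q).symm.trans_le
      (Metric.dist_le_diam_of_mem (hP₀.isCompact.isBounded.subset sdiff_subset) hp hq)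
  have hD0 : 0 ≤ Metric.diam P := Metric.diam_nonneg
  choose z hzQ hzY hzX using fun i φ => exists_lexMin (hQ i).isCompact (hQ i).nonempty
    (Frame.rot φ).Y.continuous (Frame.rot φ).X.continuous
  have hzP : ∀ i φ, z i φ ∈ P := fun i φ => hbd i ⟨hzQ i φ, fun hi => by
    obtain ⟨q, hq, -, hlt⟩ := Frame.exists_lower_of_mem_interior (F := Frame.rot φ) hi
    exact hlt.not_ge (hzY i φ q hq)⟩
  set n := ⌈√(h : ℝ)⌉₊ + 1 with hn
  have hsqrt : 0 ≤ √(h : ℝ) := Real.sqrt_nonneg _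
  have hn1 : √(h : ℝ) ≤ n := by
    rw [hn]; push_cast; linarith [Nat.le_ceil (√(h : ℝ))]
  have hn2 : (n : ℝ) ≤ √(h : ℝ) + 2 := by
    rw [hn]; push_cast; linarith [Nat.ceil_lt_add_one hsqrt]
  have hn3 : (1 : ℝ) ≤ n := by rw [hn]; push_cast; linarith [Nat.cast_nonneg (α := ℝ) ⌈√(h : ℝ)⌉₊]
  have hn0 : (0 : ℝ) < n := zero_lt_one.trans_le hn3
  obtain ⟨φ, hφ⟩ := exists_frame_bound (N := n) (Nat.succ_pos _) rfl z
    fun i φ ψ => hD _ (hzP i φ) _ (hzP i ψ)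
  rw [Fintype.card_fin] at hφ
  have hinv : (n : ℝ)⁻¹ ≤ 1 := inv_le_one_of_one_le₀ hn3
  have hinv0 : 0 < (n : ℝ)⁻¹ := inv_pos.2 hn0
  refine iSup₂_le fun s hs => iSup₂_le fun t ht => ?_
  refine (geod_le_of_frame hP₀.isCompact hP₀.convex (fun i => (hQ i).isCompact)
    (fun i => (hQ i).convex) (fun i => (hQ i).nonempty) (fun i => (hQP i).trans interior_subset)
    hbd hbd₀ hD (Frame.rot φ) (Real.cos_pos_of_le_one (by rwa [abs_of_pos hinv0]))
    (Real.sin_pos_of_pos_of_le_one hinv0 hinv) hn0.le (cos_le_mul_sin_inv hn3)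
    (fun i => z i φ) (fun i => z i (φ - (n : ℝ)⁻¹)) (fun i => z i (φ + (n : ℝ)⁻¹))
    (fun i => hzQ i φ) (fun i => hzY i φ) (fun i => hzX i φ) (fun i => hzQ i _)
    (fun i q hq => ?_) (fun i => hzQ i _) (fun i q hq => ?_) hs ht).trans
    (ENNReal.ofReal_le_ofReal ?_)
  · simpa only [Frame.rot_sub_Y] using hzY i (φ - (n : ℝ)⁻¹) q hq
  · simpa only [Frame.rot_add_Y] using hzY i (φ + (n : ℝ)⁻¹) q hq
  have hT : ∑ i, ((Frame.rot φ).X (z i (φ + (n : ℝ)⁻¹)) - (Frame.rot φ).X (z i (φ - (n : ℝ)⁻¹))) ≤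
      √(h : ℝ) * (8 * Metric.diam P) := by
    refine le_of_mul_le_mul_left (hφ.trans ?_) hn0
    have h1 := mul_le_mul_of_nonneg_right hn1 hsqrt
    rw [Real.mul_self_sqrt (Nat.cast_nonneg h)] at h1
    linarith [mul_le_mul_of_nonneg_right h1 hD0]
  have h1 := mul_le_mul_of_nonneg_right hn2 hD0
  linarith
end
end

section
/- There is an absolute constant c > 0 such that for every integer h ≥ 1 there exist a polygonal domain P = P₀ \ ⋃_{i=1}^h interior(Pᵢ) in 𝒞(h) and two points s, t ∈ P such that every continuous path from s to t whose image is contained in P has length at least c·h^{1/3}·diam₂(P). In particular, diam_g(P) ≥ c·h^{1/3}·diam₂(P), i.e., the distortion ϱ(P) is Ω(h^{1/3}). -/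
open Set Metric ENNReal RealInnerProductSpace

noncomputable section

open Real in
/-- Coordinate of `x` along the unit vector at angle `θ`. -/
def radial (θ : ℝ) (x : Plane) : ℝ := x 0 * cos θ + x 1 * sin θ

open Real in
/-- Coordinate of `x` along the unit vector at angle `θ + π / 2`. -/
def tangential (θ : ℝ) (x : Plane) : ℝ := x 1 * cos θ - x 0 * sin θ

open Real in
/-- The point with polar coordinates `(r, θ)`. -/
def polarPoint (r θ : ℝ) : Plane := !₂[r * cos θ, r * sin θ]

/-- A rectangle whose axes point in the directions `θ` and `θ + π / 2`. -/
def rotatedRect (θ a b w : ℝ) : Set Plane :=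
  {x | radial θ x ∈ Icc a b ∧ tangential θ x ∈ Icc (-w) w}

lemma continuous_radial (θ : ℝ) : Continuous (radial θ) := by
  unfold radial; fun_prop

lemma continuous_tangential (θ : ℝ) : Continuous (tangential θ) := by
  unfold tangential; fun_prop

lemma norm_sq_eq_radial_tangential (θ : ℝ) (x : Plane) :
    ‖x‖ ^ 2 = radial θ x ^ 2 + tangential θ x ^ 2 := by
  rw [EuclideanSpace.real_norm_sq_eq, Fin.sum_univ_two]
  simp only [radial, tangential]
  linear_combination (-(x 0 ^ 2 + x 1 ^ 2)) * Real.sin_sq_add_cos_sq θ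

lemma radial_le_norm (θ : ℝ) (x : Plane) : radial θ x ≤ ‖x‖ := by
  have := norm_sq_eq_radial_tangential θ x
  nlinarith [norm_nonneg x, sq_nonneg (tangential θ x)]

lemma radial_sub (θ : ℝ) (x y : Plane) :
    radial θ (x - y) = radial θ x - radial θ y := by
  simp [radial]; ring

lemma tangential_sub (θ : ℝ) (x y : Plane) :
    tangential θ (x - y) = tangential θ x - tangential θ y := by
  simp [tangential]; ring

/-- The linear map sending coordinates in the frame at angle `θ` to points of the plane. -/
def rotatedFrame (θ : ℝ) : ℝ × ℝ →ₗ[ℝ] Plane where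
  toFun p := !₂[p.1 * Real.cos θ - p.2 * Real.sin θ, p.1 * Real.sin θ + p.2 * Real.cos θ]
  map_add' p q := by ext i; fin_cases i <;> simp <;> ring
  map_smul' c p := by ext i; fin_cases i <;> simp <;> ring

lemma radial_rotatedFrame (θ : ℝ) (p : ℝ × ℝ) : radial θ (rotatedFrame θ p) = p.1 := by
  simp [radial, rotatedFrame]
  linear_combination p.1 * Real.sin_sq_add_cos_sq θ

lemma tangential_rotatedFrame (θ : ℝ) (p : ℝ × ℝ) : tangential θ (rotatedFrame θ p) = p.2 := by
  simp [tangential, rotatedFrame]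
  linear_combination p.2 * Real.sin_sq_add_cos_sq θ

lemma rotatedFrame_radial_tangential (θ : ℝ) (x : Plane) :
    rotatedFrame θ (radial θ x, tangential θ x) = x := by
  ext i
  fin_cases i <;> simp [radial, tangential, rotatedFrame]
  · linear_combination x 0 * Real.sin_sq_add_cos_sq θ
  · linear_combination x 1 * Real.sin_sq_add_cos_sq θ

lemma rotatedRect_eq_image (θ a b w : ℝ) :
    rotatedRect θ a b w = rotatedFrame θ '' (Icc a b ×ˢ Icc (-w) w) := by
  ext x
  constructor
  · rintro ⟨h₁, h₂⟩
    exact ⟨(radial θ x, tangential θ x), ⟨h₁, h₂⟩, rotatedFrame_radial_tangential θ x⟩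
  · rintro ⟨p, ⟨h₁, h₂⟩, rfl⟩
    refine ⟨?_, ?_⟩
    · rwa [radial_rotatedFrame]
    · rwa [tangential_rotatedFrame]

lemma isConvexPolygon_rotatedRect {θ a b w : ℝ} (hab : a ≤ b) (hw : 0 ≤ w) :
    IsConvexPolygon (rotatedRect θ a b w) := by
  classical
  refine ⟨(({a, b} : Finset ℝ) ×ˢ ({-w, w} : Finset ℝ)).image (rotatedFrame θ), by simp, ?_⟩
  rw [rotatedRect_eq_image, Finset.coe_image, ← LinearMap.image_convexHull, Finset.coe_product,
    convexHull_prod]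
  simp only [Finset.coe_pair, convexHull_pair]
  rw [segment_eq_Icc hab, segment_eq_Icc (by linarith)]

lemma mem_interior_rotatedRect {θ a b w : ℝ} {x : Plane} (hr : radial θ x ∈ Ioo a b)
    (ht : tangential θ x ∈ Ioo (-w) w) : x ∈ interior (rotatedRect θ a b w) := by
  have ho : IsOpen (radial θ ⁻¹' Ioo a b ∩ tangential θ ⁻¹' Ioo (-w) w) :=
    (isOpen_Ioo.preimage (continuous_radial θ)).inter
      (isOpen_Ioo.preimage (continuous_tangential θ))
  have hsub : radial θ ⁻¹' Ioo a b ∩ tangential θ ⁻¹' Ioo (-w) w ⊆ rotatedRect θ a b w :=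
    fun y hy => ⟨Ioo_subset_Icc_self hy.1, Ioo_subset_Icc_self hy.2⟩
  exact interior_maximal hsub ho ⟨hr, ht⟩

/-- Among the nonzero multiples of `2π / N`, the cosine is largest at `2π / N`. -/
lemma cos_int_mul_two_pi_div_le {N : ℕ} (hN : 0 < N) {s : ℤ} (hs : ¬ (N : ℤ) ∣ s) :
    Real.cos (s * (2 * Real.pi / N)) ≤ Real.cos (2 * Real.pi / N) := by
  have hN' : (0 : ℝ) < N := by exact_mod_cast hN
  have hNz : (0 : ℤ) < N := by exact_mod_cast hN
  have hpi := Real.pi_pos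
  have h0 : 0 ≤ 2 * Real.pi / N := by positivity
  obtain ⟨r, hr⟩ : ∃ r : ℤ, r = s % N := ⟨_, rfl⟩
  have hr0 : 1 ≤ r := by
    have h₁ := Int.emod_nonneg s hNz.ne'
    have h₂ : s % N ≠ 0 := fun h => hs (Int.dvd_of_emod_eq_zero h)
    omega
  have hrN : r ≤ N - 1 := by
    have := Int.emod_lt_of_pos s hNz
    omega
  have hsr : (s : ℝ) * (2 * Real.pi / N) =
      r * (2 * Real.pi / N) + (s / N : ℤ) * (2 * Real.pi) := by
    have h : (s : ℝ) = r + N * (s / N : ℤ) := by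
      rw [hr]; exact_mod_cast (Int.emod_add_mul_ediv s N).symm
    rw [h]; field_simp
  rw [hsr, Real.cos_add_int_mul_two_pi]
  have key : ∀ q : ℤ, 1 ≤ q → 2 * q ≤ N →
      Real.cos (q * (2 * Real.pi / N)) ≤ Real.cos (2 * Real.pi / N) := by
    intro q h1 h2
    have h1' : (1 : ℝ) ≤ q := by exact_mod_cast h1
    have h2' : 2 * (q : ℝ) ≤ N := by exact_mod_cast h2
    apply Real.cos_le_cos_of_nonneg_of_le_pi h0
    · rw [mul_div_assoc', div_le_iff₀ hN']; nlinarith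
    · nlinarith
  rcases le_total (2 * r) N with h | h
  · exact key r hr0 h
  · have := key (N - r) (by omega) (by omega)
    have e : ((N - r : ℤ) : ℝ) * (2 * Real.pi / N) = 2 * Real.pi - r * (2 * Real.pi / N) := by
      push_cast; field_simp
    rwa [e, Real.cos_two_pi_sub] at this

lemma dist_polarPoint_sq (r r' θ θ' : ℝ) :
    dist (polarPoint r θ) (polarPoint r' θ') ^ 2 =
      (r - r') ^ 2 + 2 * r * r' * (1 - Real.cos (θ - θ')) := by
  rw [EuclideanSpace.dist_eq, Real.sq_sqrt (by positivity), Fin.sum_univ_two]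
  simp only [polarPoint, Real.dist_eq, sq_abs]
  simp [Real.cos_sub]
  linear_combination r ^ 2 * Real.sin_sq_add_cos_sq θ + r' ^ 2 * Real.sin_sq_add_cos_sq θ'

lemma dist_polarPoint_of_radial_eq {θ a β : ℝ} {x : Plane} (hx : radial θ x = a)
    (hβ : Real.cos β ≠ 0) :
    dist x (polarPoint (a / Real.cos β) (θ + β)) = |tangential θ x - a * Real.tan β| := by
  rw [dist_eq_norm, ← Real.sqrt_sq (norm_nonneg _), norm_sq_eq_radial_tangential θ]
  have hr : radial θ (x - polarPoint (a / Real.cos β) (θ + β)) = 0 := by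
    rw [radial_sub, hx]
    simp [radial, polarPoint, Real.cos_add, Real.sin_add]
    field_simp
    linear_combination (-a * Real.cos β) * Real.sin_sq_add_cos_sq θ
  have ht : tangential θ (x - polarPoint (a / Real.cos β) (θ + β)) =
      tangential θ x - a * Real.tan β := by
    rw [tangential_sub, Real.tan_eq_sin_div_cos]
    congr 1
    simp [tangential, polarPoint, Real.cos_add, Real.sin_add]
    field_simp
    linear_combination (a * Real.sin β) * Real.sin_sq_add_cos_sq θ
  rw [hr, ht, ← Real.sqrt_sq_eq_abs]
  simp

lemma radial_add (θ φ : ℝ) (x : Plane) :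
    radial (θ + φ) x = radial θ x * Real.cos φ + tangential θ x * Real.sin φ := by
  simp [radial, tangential, Real.cos_add, Real.sin_add]; ring

lemma tangential_add (θ φ : ℝ) (x : Plane) :
    tangential (θ + φ) x = tangential θ x * Real.cos φ - radial θ x * Real.sin φ := by
  simp [radial, tangential, Real.cos_add, Real.sin_add]; ring

/-- If the support constraint at angle `θ` is active and the two at angles `θ ± 2β` hold, then
the point lies between the corresponding corners. -/
lemma abs_tangential_le {θ a β : ℝ} {x : Plane} (hx : radial θ x = a) (hs : 0 < Real.sin β)
    (hc : 0 < Real.cos β) (h₁ : radial (θ + 2 * β) x ≤ a) (h₂ : radial (θ + -(2 * β)) x ≤ a) :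
    |tangential θ x| ≤ a * Real.tan β := by
  rw [radial_add, hx, Real.cos_two_mul, Real.sin_two_mul] at h₁
  rw [radial_add, hx, Real.cos_neg, Real.sin_neg, Real.cos_two_mul, Real.sin_two_mul] at h₂
  have hsc := Real.sin_sq_add_cos_sq β
  rw [Real.tan_eq_sin_div_cos, mul_div_assoc', le_div_iff₀ hc]
  have e : ∀ v : ℝ, a * (2 * Real.cos β ^ 2 - 1) + v * (2 * Real.sin β * Real.cos β) ≤ a →
      v * Real.cos β ≤ a * Real.sin β := by
    intro v hv
    have : 2 * Real.sin β * (v * Real.cos β) ≤ 2 * Real.sin β * (a * Real.sin β) := by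
      linear_combination hv - (2 * a) * hsc
    exact le_of_mul_le_mul_left this (by positivity)
  rcases abs_cases (tangential θ x) with ⟨h, -⟩ | ⟨h, -⟩ <;> rw [h]
  · exact e _ h₁
  · exact e _ (by linarith)

/-- The open sectors of half-angle `β` around two directions at angle at least `2β` are
disjoint. -/
lemma sectors_disjoint {θ φ β : ℝ} {x : Plane} (hs : 0 < Real.sin β) (hc : 0 < Real.cos β)
    (hβ : 0 < Real.cos (2 * β)) (hφ : Real.cos φ ≤ Real.cos (2 * β))
    (h₁ : |tangential θ x| < radial θ x * Real.tan β)
    (h₂ : |tangential (θ + φ) x| < radial (θ + φ) x * Real.tan β) : False := by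
  have hsq := norm_sq_eq_radial_tangential θ x
  have hsq' := norm_sq_eq_radial_tangential (θ + φ) x
  have hdot : ‖x‖ ^ 2 * Real.cos φ =
      radial θ x * radial (θ + φ) x + tangential θ x * tangential (θ + φ) x := by
    rw [hsq, radial_add, tangential_add]; ring
  set u := radial θ x
  set v := tangential θ x
  set u' := radial (θ + φ) x
  set v' := tangential (θ + φ) x
  have hT : 0 < Real.tan β := by rw [Real.tan_eq_sin_div_cos]; positivity
  set T := Real.tan β with hTdef
  have hu : 0 < u := pos_of_mul_pos_left ((abs_nonneg v).trans_lt h₁) hT.le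
  have hu' : 0 < u' := pos_of_mul_pos_left ((abs_nonneg v').trans_lt h₂) hT.le
  have hcos : Real.cos (2 * β) * (1 + T ^ 2) = 1 - T ^ 2 := by
    rw [Real.cos_two_mul, hTdef, Real.tan_eq_sin_div_cos]
    field_simp
    linear_combination (2 * Real.cos β ^ 2) * Real.sin_sq_add_cos_sq β
  have hvv : -(v * v') < u * u' * T ^ 2 := by
    have : |v| * |v'| < (u * T) * (u' * T) := mul_lt_mul'' h₁ h₂ (abs_nonneg _) (abs_nonneg _)
    have := neg_abs_le (v * v')
    rw [abs_mul] at this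
    nlinarith
  have hN : ‖x‖ ^ 2 < u * u' * (1 + T ^ 2) := by
    have e₁ : ‖x‖ ^ 2 < u ^ 2 * (1 + T ^ 2) := by
      have : |v| ^ 2 < (u * T) ^ 2 := by gcongr
      rw [sq_abs] at this; nlinarith
    have e₂ : ‖x‖ ^ 2 < u' ^ 2 * (1 + T ^ 2) := by
      have : |v'| ^ 2 < (u' * T) ^ 2 := by gcongr
      rw [sq_abs] at this; nlinarith
    have : (‖x‖ ^ 2) ^ 2 < (u * u' * (1 + T ^ 2)) ^ 2 := by
      have := mul_lt_mul'' e₁ e₂ (by positivity) (by positivity)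
      nlinarith
    exact lt_of_pow_lt_pow_left₀ 2 (by positivity) this
  have : ‖x‖ ^ 2 * Real.cos φ ≤ u * u' * (1 - T ^ 2) := by
    rw [← hcos]
    calc ‖x‖ ^ 2 * Real.cos φ ≤ ‖x‖ ^ 2 * Real.cos (2 * β) := by gcongr
      _ ≤ u * u' * (1 + T ^ 2) * Real.cos (2 * β) := by gcongr
      _ = _ := by ring
  nlinarith

/-- Inradius of the `j`-th layer of holes. -/
def layerRadius (m j : ℕ) : ℝ := 1 + 20 * j / (m : ℝ) ^ 2

/-- Direction of the `l`-th hole in layer `j`; consecutive layers are rotated by `π / m`. -/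
def layerAngle (m j : ℕ) (l : ℤ) : ℝ := (2 * l + (j % 2 : ℕ)) * (Real.pi / m)

/-- The `l`-th hole of layer `j`: a thin rectangle along a side of a regular `m`-gon. -/
def layerHole (m j : ℕ) (l : ℤ) : Set Plane :=
  rotatedRect (layerAngle m j l) (layerRadius m j - 1 / (m : ℝ) ^ 2)
    (layerRadius m j + 1 / (m : ℝ) ^ 2)
    (layerRadius m j * Real.tan (Real.pi / m) - 1 / (2 * m))

/-- The corner of the `m`-gon of layer `j` following its `l`-th side. -/
def layerCorner (m j : ℕ) (l : ℤ) : Plane :=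
  polarPoint (layerRadius m j / Real.cos (Real.pi / m)) (layerAngle m j l + Real.pi / m)

/-- Support function of the normals of layer `j`; its sublevel sets are regular `m`-gons. -/
def layerGauge (m : ℕ) (hm : 0 < m) (j : ℕ) (x : Plane) : ℝ :=
  (Finset.range m).sup' (Finset.nonempty_range_iff.2 hm.ne')
    fun k => radial (layerAngle m j (k : ℤ)) x

lemma one_le_layerRadius (m j : ℕ) : 1 ≤ layerRadius m j := by
  unfold layerRadius
  have : (0 : ℝ) ≤ 20 * j / (m : ℝ) ^ 2 := by positivity
  linarith

lemma layerRadius_succ (m j : ℕ) :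
    layerRadius m (j + 1) = layerRadius m j + 20 / (m : ℝ) ^ 2 := by
  unfold layerRadius; push_cast; ring

lemma layerRadius_le_two {m j : ℕ} (hj : 20 * j ≤ m ^ 2) : layerRadius m j ≤ 2 := by
  have h : (20 * j : ℝ) ≤ (m : ℝ) ^ 2 := by exact_mod_cast hj
  have : 20 * (j : ℝ) / (m : ℝ) ^ 2 ≤ 1 := div_le_one_of_le₀ h (by positivity)
  unfold layerRadius; linarith

lemma layerRadius_add_le {m i j : ℕ} (hij : i < j) :
    layerRadius m i + 20 / (m : ℝ) ^ 2 ≤ layerRadius m j := by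
  rw [← layerRadius_succ]
  have : ((i + 1 : ℕ) : ℝ) ≤ j := by exact_mod_cast hij
  unfold layerRadius
  gcongr

lemma pi_div_bounds {m : ℕ} (hm : 20 ≤ m) :
    0 < Real.pi / m ∧ Real.pi / m ≤ 3.15 / m ∧ Real.pi / m ≤ 0.16 := by
  have hm' : (20 : ℝ) ≤ m := by exact_mod_cast hm
  have h := Real.pi_lt_d2
  refine ⟨by positivity, by gcongr, ?_⟩
  rw [div_le_iff₀ (by linarith)]; nlinarith

lemma cos_pi_div_ge {m : ℕ} (hm : 20 ≤ m) : 0.98 ≤ Real.cos (Real.pi / m) := by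
  obtain ⟨h₁, -, h₂⟩ := pi_div_bounds hm
  have := Real.one_sub_sq_div_two_le_cos (x := Real.pi / m)
  nlinarith

lemma sin_pi_div_pos {m : ℕ} (hm : 20 ≤ m) : 0 < Real.sin (Real.pi / m) := by
  obtain ⟨h₁, -, h₂⟩ := pi_div_bounds hm
  exact Real.sin_pos_of_pos_of_lt_pi h₁ (by linarith [Real.pi_gt_three])

lemma le_tan_pi_div {m : ℕ} (hm : 20 ≤ m) : 3 / (m : ℝ) ≤ Real.tan (Real.pi / m) := by
  obtain ⟨h₁, -, h₂⟩ := pi_div_bounds hm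
  have h := Real.lt_tan h₁ (by linarith [Real.pi_gt_three])
  have : 3 / (m : ℝ) ≤ Real.pi / m := by gcongr; exact Real.pi_gt_three.le
  linarith

lemma tan_pi_div_le {m : ℕ} (hm : 20 ≤ m) : Real.tan (Real.pi / m) ≤ 3.5 / m := by
  obtain ⟨h₁, h₂, -⟩ := pi_div_bounds hm
  have hm' : (20 : ℝ) ≤ m := by exact_mod_cast hm
  have hc := cos_pi_div_ge hm
  rw [Real.tan_eq_sin_div_cos, div_le_iff₀ (by linarith)]
  have hs := Real.sin_lt h₁
  have : 3.15 / (m : ℝ) ≤ 3.5 / m * 0.98 := by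
    rw [div_mul_eq_mul_div]; gcongr; norm_num
  have : 3.5 / (m : ℝ) * 0.98 ≤ 3.5 / m * Real.cos (Real.pi / m) := by gcongr
  linarith

lemma norm_lt_of_radial_tangential {m : ℕ} (hm : 20 ≤ m) {θ a : ℝ} {x : Plane}
    (ha : 1 ≤ a) (ha' : a ≤ 2)
    (hr : 0 ≤ radial θ x) (hr' : radial θ x ≤ a + 1 / (m : ℝ) ^ 2)
    (ht : |tangential θ x| ≤ a * Real.tan (Real.pi / m)) :
    ‖x‖ < a + 19 / (m : ℝ) ^ 2 := by
  have hm' : (20 : ℝ) ≤ m := by exact_mod_cast hm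
  have hd : 0 < 1 / (m : ℝ) ^ 2 := by positivity
  have hT : |tangential θ x| ≤ a * (3.5 / m) :=
    ht.trans (by gcongr; exact tan_pi_div_le hm)
  have h₁ : |tangential θ x| ^ 2 ≤ (a * (3.5 / m)) ^ 2 := by gcongr
  have h₂ : radial θ x ^ 2 ≤ (a + 1 / (m : ℝ) ^ 2) ^ 2 := by gcongr
  have h₃ : (a * (3.5 / m)) ^ 2 = 12.25 * a ^ 2 * (1 / (m : ℝ) ^ 2) := by ring
  have h₄ : 19 / (m : ℝ) ^ 2 = 19 * (1 / (m : ℝ) ^ 2) := by ring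
  rw [sq_abs, h₃] at h₁
  rw [h₄]
  set d := 1 / (m : ℝ) ^ 2
  refine lt_of_pow_lt_pow_left₀ 2 (by positivity) ?_
  rw [norm_sq_eq_radial_tangential θ]
  have h₅ : a ^ 2 * d ≤ 2 * a * d := by gcongr; nlinarith
  have h₆ : 0 < a * d := by positivity
  nlinarith

lemma norm_bounds_of_mem_layerHole {m : ℕ} (hm : 20 ≤ m) {j : ℕ} (hj : 20 * j ≤ m ^ 2) {l : ℤ}
    {x : Plane} (hx : x ∈ layerHole m j l) :
    layerRadius m j - 1 / (m : ℝ) ^ 2 ≤ ‖x‖ ∧ ‖x‖ < layerRadius m j + 19 / (m : ℝ) ^ 2 := by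
  obtain ⟨⟨h₁, h₂⟩, h₃⟩ := hx
  have hm' : (20 : ℝ) ≤ m := by exact_mod_cast hm
  have ha := one_le_layerRadius m j
  have hd : 1 / (m : ℝ) ^ 2 ≤ 1 := div_le_one_of_le₀ (by nlinarith) (by positivity)
  refine ⟨h₁.trans (radial_le_norm _ _), norm_lt_of_radial_tangential hm ha
    (layerRadius_le_two hj) (by linarith) h₂ ((abs_le.2 h₃).trans ?_)⟩
  have : 0 < 1 / (2 * (m : ℝ)) := by positivity
  linarith

lemma isConvexPolygon_layerHole {m : ℕ} (hm : 20 ≤ m) (j : ℕ) (l : ℤ) :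
    IsConvexPolygon (layerHole m j l) := by
  have hm' : (20 : ℝ) ≤ m := by exact_mod_cast hm
  have hd : 0 < 1 / (m : ℝ) ^ 2 := by positivity
  apply isConvexPolygon_rotatedRect (by linarith)
  have h₁ := le_tan_pi_div hm
  have h₂ := one_le_layerRadius m j
  have h₃ : 1 / (2 * (m : ℝ)) ≤ 3 / m := by
    rw [div_le_div_iff₀ (by positivity) (by positivity)]; linarith
  have : 0 < 3 / (m : ℝ) := by positivity
  nlinarith

lemma abs_tangential_lt_of_mem_layerHole {m : ℕ} (hm : 20 ≤ m) {j : ℕ} {l : ℤ} {x : Plane}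
    (hx : x ∈ layerHole m j l) :
    |tangential (layerAngle m j l) x| <
      radial (layerAngle m j l) x * Real.tan (Real.pi / m) := by
  obtain ⟨⟨h₁, -⟩, h₂⟩ := hx
  have hm' : (20 : ℝ) ≤ m := by exact_mod_cast hm
  have hT := tan_pi_div_le hm
  have hT' := le_tan_pi_div hm
  have hT0 : 0 < 3 / (m : ℝ) := by positivity
  have h₃ : 1 / (m : ℝ) ^ 2 * Real.tan (Real.pi / m) < 1 / (2 * (m : ℝ)) := by
    calc 1 / (m : ℝ) ^ 2 * Real.tan (Real.pi / m) ≤ 1 / (m : ℝ) ^ 2 * (3.5 / m) := by gcongr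
      _ < 1 / (2 * (m : ℝ)) := by
        rw [div_mul_div_comm, div_lt_div_iff₀ (by positivity) (by positivity)]
        have : 0 < (m : ℝ) := by linarith
        nlinarith [mul_pos this this]
  have := abs_le.2 h₂
  nlinarith

lemma disjoint_layerHole_same {m : ℕ} (hm : 20 ≤ m) (j : ℕ) {l l' : ℤ} (h : ¬ (m : ℤ) ∣ l' - l) :
    Disjoint (layerHole m j l) (layerHole m j l') := by
  rw [Set.disjoint_left]
  intro x hx hx'
  have h₁ := abs_tangential_lt_of_mem_layerHole hm hx
  have h₂ := abs_tangential_lt_of_mem_layerHole hm hx'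
  have hang : layerAngle m j l' =
      layerAngle m j l + ((l' - l : ℤ) : ℝ) * (2 * Real.pi / m) := by
    unfold layerAngle; push_cast; ring
  rw [hang] at h₂
  have hc := cos_pi_div_ge hm
  refine sectors_disjoint (sin_pi_div_pos hm) (by linarith) ?_ ?_ h₁ h₂
  · rw [Real.cos_two_mul]; nlinarith
  · rw [← mul_div_assoc 2 Real.pi]
    exact cos_int_mul_two_pi_div_le (by omega) h

lemma disjoint_layerHole_of_lt {m : ℕ} (hm : 20 ≤ m) {i j : ℕ} (hij : i < j)
    (hj : 20 * j ≤ m ^ 2) (l l' : ℤ) :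
    Disjoint (layerHole m i l) (layerHole m j l') := by
  rw [Set.disjoint_left]
  intro x hx hx'
  have h₁ := (norm_bounds_of_mem_layerHole hm (by omega) hx).2
  have h₂ := (norm_bounds_of_mem_layerHole hm hj hx').1
  have h₃ := layerRadius_add_le (m := m) hij
  have : 20 / (m : ℝ) ^ 2 = 19 / (m : ℝ) ^ 2 + 1 / (m : ℝ) ^ 2 := by ring
  linarith

lemma radial_le_layerGauge {m : ℕ} (hm : 20 ≤ m) (j : ℕ) (l : ℤ) (x : Plane) :
    radial (layerAngle m j l) x ≤ layerGauge m (by omega) j x := by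
  have hmz : (0 : ℤ) < m := by omega
  have hm' : (0 : ℝ) < m := by exact_mod_cast hmz
  obtain ⟨k, hk⟩ := Int.eq_ofNat_of_zero_le (Int.emod_nonneg l hmz.ne')
  have hkm : k < m := by have := Int.emod_lt_of_pos l hmz; omega
  have hang : layerAngle m j l = layerAngle m j (k : ℤ) + (l / m : ℤ) * (2 * Real.pi) := by
    have h : (l : ℝ) = (k : ℤ) + m * (l / m : ℤ) := by
      rw [← hk]; exact_mod_cast (Int.emod_add_mul_ediv l m).symm
    unfold layerAngle
    rw [h]; field_simp; ring
  have hrad : radial (layerAngle m j l) x = radial (layerAngle m j (k : ℤ)) x := by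
    rw [hang, radial, Real.cos_add_int_mul_two_pi, Real.sin_add_int_mul_two_pi, radial]
  rw [hrad]
  exact Finset.le_sup' (fun k : ℕ => radial (layerAngle m j (k : ℤ)) x) (Finset.mem_range.2 hkm)

lemma continuous_layerGauge {m : ℕ} (hm : 0 < m) (j : ℕ) : Continuous (layerGauge m hm j) := by
  unfold layerGauge
  exact Continuous.finset_sup'_apply _ fun k _ => continuous_radial _

lemma layerGauge_le_norm {m : ℕ} (hm : 0 < m) (j : ℕ) (x : Plane) : layerGauge m hm j x ≤ ‖x‖ :=
  Finset.sup'_le _ _ fun _ _ => radial_le_norm _ _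

/-- A point on the boundary polygon of layer `j` which avoids the holes is close to a corner. -/
lemma exists_layerCorner_near {m : ℕ} (hm : 20 ≤ m) {j : ℕ} (hj : 20 * j ≤ m ^ 2) {x : Plane}
    (hx : layerGauge m (by omega) j x = layerRadius m j)
    (hxh : ∀ l < m, x ∉ interior (layerHole m j (l : ℤ))) :
    ‖x‖ < layerRadius m (j + 1) ∧
      ∃ l : ℤ, dist x (layerCorner m j l) ≤ 1 / (2 * m) := by
  have hm' : (20 : ℝ) ≤ m := by exact_mod_cast hm
  have hd : 0 < 1 / (m : ℝ) ^ 2 := by positivity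
  have ha := one_le_layerRadius m j
  have hs := sin_pi_div_pos hm
  have hc : 0 < Real.cos (Real.pi / m) := by linarith [cos_pi_div_ge hm]
  obtain ⟨k, hkm, hk⟩ := Finset.exists_mem_eq_sup' (Finset.nonempty_range_iff.2 (by omega))
    (fun k : ℕ => radial (layerAngle m j (k : ℤ)) x) (s := Finset.range m)
  rw [Finset.mem_range] at hkm
  have hrad : radial (layerAngle m j (k : ℤ)) x = layerRadius m j := by rw [← hx, ← hk]; rfl
  have e₁ : layerAngle m j (k : ℤ) + 2 * (Real.pi / m) = layerAngle m j (k + 1 : ℤ) := by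
    unfold layerAngle; push_cast; ring
  have e₂ : layerAngle m j (k : ℤ) + -(2 * (Real.pi / m)) = layerAngle m j (k - 1 : ℤ) := by
    unfold layerAngle; push_cast; ring
  have ht : |tangential (layerAngle m j (k : ℤ)) x| ≤
      layerRadius m j * Real.tan (Real.pi / m) := by
    apply abs_tangential_le hrad hs hc
    · rw [e₁, ← hx]; exact radial_le_layerGauge hm _ _ _
    · rw [e₂, ← hx]; exact radial_le_layerGauge hm _ _ _
  have ht' : layerRadius m j * Real.tan (Real.pi / m) - 1 / (2 * m) ≤
      |tangential (layerAngle m j (k : ℤ)) x| := by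
    by_contra! hlt
    refine hxh k hkm (mem_interior_rotatedRect ?_ (abs_lt.1 hlt))
    rw [hrad]
    constructor <;> linarith
  constructor
  · have := norm_lt_of_radial_tangential hm ha (layerRadius_le_two hj)
      (by linarith) (by linarith) ht
    have e : 20 / (m : ℝ) ^ 2 = 19 / (m : ℝ) ^ 2 + 1 / (m : ℝ) ^ 2 := by ring
    rw [layerRadius_succ]; linarith
  · rcases abs_cases (tangential (layerAngle m j (k : ℤ)) x) with ⟨h, -⟩ | ⟨h, -⟩
    · refine ⟨k, ?_⟩
      rw [layerCorner, dist_polarPoint_of_radial_eq hrad hc.ne', abs_le]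
      have : 0 < 1 / (2 * (m : ℝ)) := by positivity
      constructor <;> linarith
    · refine ⟨k - 1, ?_⟩
      have e : layerAngle m j (k - 1 : ℤ) + Real.pi / m =
          layerAngle m j (k : ℤ) + -(Real.pi / m) := by
        unfold layerAngle; push_cast; ring
      rw [layerCorner, e, ← Real.cos_neg,
        dist_polarPoint_of_radial_eq hrad (by rw [Real.cos_neg]; exact hc.ne'),
        Real.tan_neg, abs_le]
      have : 0 < 1 / (2 * (m : ℝ)) := by positivity
      constructor <;> linarith

lemma two_div_le_dist_layerCorner {m : ℕ} (hm : 20 ≤ m) (j : ℕ) (l l' : ℤ) :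
    2 / (m : ℝ) ≤ dist (layerCorner m j l) (layerCorner m (j + 1) l') := by
  have hm' : (20 : ℝ) ≤ m := by exact_mod_cast hm
  have hc : 0 < Real.cos (Real.pi / m) := by linarith [cos_pi_div_ge hm]
  have hr : ∀ i, 1 ≤ layerRadius m i / Real.cos (Real.pi / m) := fun i => by
    rw [one_le_div hc]
    exact (Real.cos_le_one _).trans (one_le_layerRadius m i)
  refine le_of_sq_le_sq ?_ dist_nonneg
  rw [layerCorner, layerCorner, dist_polarPoint_sq]
  obtain ⟨d, hd, hang⟩ : ∃ d : ℤ, ¬ ((2 * m : ℕ) : ℤ) ∣ d ∧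
      layerAngle m j l + Real.pi / m - (layerAngle m (j + 1) l' + Real.pi / m) =
        d * (2 * Real.pi / (2 * m : ℕ)) := by
    refine ⟨2 * l + (j % 2 : ℕ) - (2 * l' + ((j + 1) % 2 : ℕ)), ?_, ?_⟩
    · rintro ⟨q, hq⟩
      push_cast at hq
      rw [mul_assoc] at hq
      omega
    · simp only [layerAngle, Int.cast_sub, Int.cast_add, Int.cast_mul, Int.cast_ofNat,
        Int.cast_natCast, Nat.cast_mul, Nat.cast_ofNat]
      field_simp
      ring
  have hcos := cos_int_mul_two_pi_div_le (N := 2 * m) (by omega) hd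
  rw [← hang] at hcos
  have e : 2 * Real.pi / (2 * m : ℕ) = Real.pi / m := by push_cast; field_simp
  rw [e] at hcos
  obtain ⟨h₁, -, h₂⟩ := pi_div_bounds hm
  have hq := Real.cos_le_one_sub_mul_cos_sq (x := Real.pi / m)
    (by rw [abs_of_pos h₁]; linarith [Real.pi_gt_three])
  have e₂ : 2 / Real.pi ^ 2 * (Real.pi / m) ^ 2 = 2 / (m : ℝ) ^ 2 := by
    have := Real.pi_pos
    field_simp
  rw [e₂] at hq
  have hpos : 0 < 2 / (m : ℝ) ^ 2 := by positivity
  have hsq : (2 / (m : ℝ)) ^ 2 = 2 * (2 / (m : ℝ) ^ 2) := by ring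
  rw [hsq]
  have hrr := one_le_mul_of_one_le_of_one_le (hr j) (hr (j + 1))
  have := sq_nonneg (layerRadius m j / Real.cos (Real.pi / m) -
    layerRadius m (j + 1) / Real.cos (Real.pi / m))
  nlinarith

lemma layerRadius_lt_layerGauge {m : ℕ} (hm : 20 ≤ m) {j : ℕ} (hj : 20 * j ≤ m ^ 2) :
    layerRadius m j < layerGauge m (by omega) j (polarPoint 4 0) := by
  refine lt_of_lt_of_le ?_ (radial_le_layerGauge hm j 0 _)
  have h := layerRadius_le_two hj
  have hc := cos_pi_div_ge hm
  rcases Nat.mod_two_eq_zero_or_one j with h' | h' <;>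
    simp [radial, polarPoint, layerAngle, h'] <;> linarith

/-- A path leaving all layers passes near a corner of each of them, in order. -/
lemma exists_time_near_layerCorner {m : ℕ} (hm : 20 ≤ m) {P : Set Plane} {γ : ℝ → Plane}
    (hγ : IsPathIn P γ 0 (polarPoint 4 0)) {K : ℕ} (hK : 20 * K ≤ m ^ 2)
    (hP : ∀ j < K, ∀ l < m, Disjoint P (interior (layerHole m j (l : ℤ)))) {j : ℕ}
    (hj : j < K) :
    ∃ τ ∈ Icc (0 : ℝ) 1, ‖γ τ‖ < layerRadius m (j + 1) ∧
      (∃ l : ℤ, dist (γ τ) (layerCorner m j l) ≤ 1 / (2 * m)) ∧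
      ENNReal.ofReal (j / m) ≤ eVariationOn γ (Icc 0 τ) := by
  have hm' : (20 : ℝ) ≤ m := by exact_mod_cast hm
  obtain ⟨hcont, h0, h1, hmaps⟩ := hγ
  have cross : ∀ i < K, ∀ σ ∈ Icc (0 : ℝ) 1, ‖γ σ‖ < layerRadius m i →
      ∃ τ ∈ Icc σ 1, ‖γ τ‖ < layerRadius m (i + 1) ∧
        ∃ l : ℤ, dist (γ τ) (layerCorner m i l) ≤ 1 / (2 * m) := by
    intro i hi σ hσ hnorm
    have hc : ContinuousOn (fun t => layerGauge m (by omega) i (γ t)) (Icc σ 1) :=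
      (continuous_layerGauge (by omega) i).comp_continuousOn
        (hcont.mono (Icc_subset_Icc_left hσ.1))
    obtain ⟨τ, hτ, hτe⟩ := intermediate_value_Icc hσ.2 hc (show layerRadius m i ∈ _ from
      ⟨(layerGauge_le_norm _ _ _).trans hnorm.le, by
        rw [h1]; exact (layerRadius_lt_layerGauge hm (by omega)).le⟩)
    exact ⟨τ, hτ, exists_layerCorner_near hm (by omega) hτe fun l hl =>
      Set.disjoint_left.1 (hP i hi l hl) (hmaps ⟨hσ.1.trans hτ.1, hτ.2⟩)⟩
  induction j with
  | zero =>
    obtain ⟨τ, hτ, h₂, h₃⟩ := cross 0 hj 0 (by simp) (by simp [h0, layerRadius])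
    exact ⟨τ, hτ, h₂, h₃, by simp⟩
  | succ j ih =>
    obtain ⟨σ, hσ, h₁, ⟨l, hl⟩, h₂⟩ := ih (by omega)
    obtain ⟨τ, hτ, h₃, l', hl'⟩ := cross (j + 1) hj σ hσ h₁
    refine ⟨τ, ⟨hσ.1.trans hτ.1, hτ.2⟩, h₃, ⟨l', hl'⟩, ?_⟩
    have hdist : 1 / (m : ℝ) ≤ dist (γ σ) (γ τ) := by
      have t₁ := two_div_le_dist_layerCorner hm j l l'
      have t₂ := dist_triangle4 (layerCorner m j l) (γ σ) (γ τ) (layerCorner m (j + 1) l')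
      rw [dist_comm _ (γ σ)] at t₂
      have e : 2 / (m : ℝ) = 1 / m + 1 / (2 * m) + 1 / (2 * m) := by field_simp; norm_num
      linarith
    have hadd := eVariationOn.Icc_add_Icc γ (s := univ) hσ.1 hτ.1 (mem_univ _)
    simp only [univ_inter] at hadd
    rw [← hadd]
    have e : ((j + 1 : ℕ) : ℝ) / m = j / m + 1 / m := by push_cast; ring
    rw [e, ENNReal.ofReal_add (by positivity) (by positivity)]
    refine add_le_add h₂ (le_trans ?_ (eVariationOn.edist_le γ (left_mem_Icc.2 hτ.1)
      (right_mem_Icc.2 hτ.1)))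
    rw [edist_dist]
    exact ENNReal.ofReal_le_ofReal hdist

lemma le_pathLen_of_disjoint_layerHoles {m : ℕ} (hm : 20 ≤ m) {P : Set Plane} {γ : ℝ → Plane}
    (hγ : IsPathIn P γ 0 (polarPoint 4 0)) {K : ℕ} (hK : 20 * K ≤ m ^ 2)
    (hP : ∀ j < K, ∀ l < m, Disjoint P (interior (layerHole m j (l : ℤ)))) {j : ℕ}
    (hj : j < K) : ENNReal.ofReal (j / m) ≤ pathLen γ := by
  obtain ⟨τ, hτ, -, -, h⟩ := exists_time_near_layerCorner hm hγ hK hP hj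
  exact h.trans (eVariationOn.mono γ (Icc_subset_Icc_right hτ.2))

lemma norm_polarPoint {r : ℝ} (hr : 0 ≤ r) (θ : ℝ) : ‖polarPoint r θ‖ = r := by
  rw [← Real.sqrt_sq (norm_nonneg _), norm_sq_eq_radial_tangential 0]
  have : radial 0 (polarPoint r θ) ^ 2 + tangential 0 (polarPoint r θ) ^ 2 = r ^ 2 := by
    simp [radial, tangential, polarPoint]
    linear_combination r ^ 2 * Real.sin_sq_add_cos_sq θ
  rw [this, Real.sqrt_sq hr]

/-- The holes: `20 * n ^ 2` layers of `20 * n` thin rectangles, then single points. -/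
def nestedHole (n i : ℕ) : Set Plane :=
  if i < 20 * n * (20 * n ^ 2) then layerHole (20 * n) (i / (20 * n)) (i % (20 * n) : ℕ)
  else {polarPoint (3 + 1 / (i + 1)) 0}

lemma div_lt_layers {n i : ℕ} (hi : i < 20 * n * (20 * n ^ 2)) : i / (20 * n) < 20 * n ^ 2 :=
  Nat.div_lt_of_lt_mul hi

lemma twenty_mul_le_sq {n j : ℕ} (hj : j ≤ 20 * n ^ 2) : 20 * j ≤ (20 * n) ^ 2 := by
  nlinarith

lemma pos_of_lt_layers {n i : ℕ} (hi : i < 20 * n * (20 * n ^ 2)) : 0 < n := by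
  rcases Nat.eq_zero_or_pos n with rfl | h
  · simp at hi
  · exact h

lemma norm_lt_three_of_mem_layerHole {n j : ℕ} (hn : 0 < n) (hj : j ≤ 20 * n ^ 2) {l : ℤ}
    {x : Plane} (hx : x ∈ layerHole (20 * n) j l) : 0 < ‖x‖ ∧ ‖x‖ < 3 := by
  have hj' := twenty_mul_le_sq hj
  obtain ⟨h₁, h₂⟩ := norm_bounds_of_mem_layerHole (by omega) hj' hx
  have h₃ := layerRadius_le_two hj'
  have h₄ := one_le_layerRadius (20 * n) j
  have hm : (20 : ℝ) ≤ (20 * n : ℕ) := by exact_mod_cast (by omega : 20 ≤ 20 * n)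
  have h₅ : 19 / ((20 * n : ℕ) : ℝ) ^ 2 < 1 := by
    rw [div_lt_one (by positivity)]; nlinarith
  have h₆ : 1 / ((20 * n : ℕ) : ℝ) ^ 2 < 1 := by
    rw [div_lt_one (by positivity)]; nlinarith
  constructor <;> linarith

lemma isConvexPolygon_nestedHole (n i : ℕ) : IsConvexPolygon (nestedHole n i) := by
  unfold nestedHole
  split_ifs with hi
  · have := pos_of_lt_layers hi
    exact isConvexPolygon_layerHole (by omega) _ _
  · exact ⟨{polarPoint (3 + 1 / (i + 1)) 0}, by simp, by simp⟩

lemma disjoint_nestedHole {n i j : ℕ} (hij : i < j) :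
    Disjoint (nestedHole n i) (nestedHole n j) := by
  have hnorm : ∀ k : ℕ, ‖polarPoint (3 + 1 / (k + 1)) 0‖ = 3 + 1 / (k + 1) := fun k =>
    norm_polarPoint (by positivity) 0
  unfold nestedHole
  split_ifs with hi hj hj
  · have hn := pos_of_lt_layers hi
    have hjl := div_lt_layers hj
    rcases (Nat.div_le_div_right hij.le : i / (20 * n) ≤ j / (20 * n)).lt_or_eq with h | h
    · exact disjoint_layerHole_of_lt (by omega) h (twenty_mul_le_sq hjl.le) _ _
    · rw [h]
      apply disjoint_layerHole_same (by omega)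
      have hi' := Nat.mod_lt i (show 0 < 20 * n by omega)
      have hj' := Nat.mod_lt j (show 0 < 20 * n by omega)
      have hi₂ := Nat.div_add_mod i (20 * n)
      have hj₂ := Nat.div_add_mod j (20 * n)
      rw [h] at hi₂
      intro hdvd
      have := Int.eq_zero_of_abs_lt_dvd hdvd (by rw [abs_lt]; omega)
      omega
  · rw [Set.disjoint_singleton_right]
    intro hx
    have := (norm_lt_three_of_mem_layerHole (pos_of_lt_layers hi) (div_lt_layers hi).le hx).2
    rw [hnorm] at this
    have : (0 : ℝ) < 1 / (j + 1) := by positivity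
    linarith
  · omega
  · rw [Set.disjoint_singleton]
    intro h
    have h' := congrArg norm h
    rw [hnorm, hnorm] at h'
    have : (1 : ℝ) / (j + 1) < 1 / (i + 1) := by
      gcongr
    linarith

lemma norm_lt_five_of_mem_nestedHole {n i : ℕ} {x : Plane} (hx : x ∈ nestedHole n i) :
    ‖x‖ < 5 := by
  unfold nestedHole at hx
  split_ifs at hx with hi
  · linarith [(norm_lt_three_of_mem_layerHole (pos_of_lt_layers hi) (div_lt_layers hi).le hx).2]
  · rw [mem_singleton_iff.1 hx, norm_polarPoint (by positivity)]
    have : (1 : ℝ) / (i + 1) ≤ 1 := div_le_one_of_le₀ (by linarith [i.cast_nonneg (α := ℝ)])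
      (by positivity)
    linarith

lemma norm_of_mem_interior_nestedHole {n i : ℕ} {x : Plane}
    (hx : x ∈ interior (nestedHole n i)) : 0 < ‖x‖ ∧ ‖x‖ < 3 := by
  unfold nestedHole at hx
  split_ifs at hx with hi
  · exact norm_lt_three_of_mem_layerHole (pos_of_lt_layers hi) (div_lt_layers hi).le
      (interior_subset hx)
  · simp [interior_singleton] at hx

lemma mem_interior_square_of_norm_lt {x : Plane} (hx : ‖x‖ < 5) :
    x ∈ interior (rotatedRect 0 (-5) 5 5) := by
  have h := norm_sq_eq_radial_tangential 0 x
  have h' : ‖x‖ ^ 2 < 5 ^ 2 := by gcongr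
  apply mem_interior_rotatedRect <;> rw [mem_Ioo, ← abs_lt] <;>
    refine abs_lt_of_sq_lt_sq ?_ (by norm_num) <;>
    nlinarith [sq_nonneg (radial 0 x), sq_nonneg (tangential 0 x)]

lemma diam_le_of_subset_square {P : Set Plane} (hP : P ⊆ rotatedRect 0 (-5) 5 5) :
    Metric.diam P ≤ 16 := by
  have hsub : P ⊆ Metric.closedBall 0 8 := by
    intro x hx
    obtain ⟨⟨h₁, h₂⟩, h₃, h₄⟩ := hP hx
    rw [mem_closedBall_zero_iff]
    have h := norm_sq_eq_radial_tangential 0 x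
    nlinarith [norm_nonneg x]
  have := Metric.diam_mono hsub Metric.isBounded_closedBall
  linarith [Metric.diam_closedBall (x := (0 : Plane)) (show (0 : ℝ) ≤ 8 by norm_num)]

lemma le_pathLen_of_disjoint_nestedHoles {n h : ℕ} (hnh : 20 * n * (20 * n ^ 2) ≤ h)
    {P : Set Plane} (hP : ∀ i < h, Disjoint P (interior (nestedHole n i))) {γ : ℝ → Plane}
    (hγ : IsPathIn P γ 0 (polarPoint 4 0)) :
    ENNReal.ofReal (8 / 25 * (n + 1)) ≤ pathLen γ := by
  rcases Nat.eq_zero_or_pos n with rfl | hn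
  · refine le_trans ?_ (eVariationOn.edist_le γ (left_mem_Icc.2 zero_le_one)
      (right_mem_Icc.2 zero_le_one))
    rw [hγ.2.1, hγ.2.2.1, edist_dist, dist_zero_left, norm_polarPoint (by norm_num)]
    exact ENNReal.ofReal_le_ofReal (by norm_num)
  · have hK : 20 * n ^ 2 - 1 < 20 * n ^ 2 := Nat.sub_lt (by positivity) one_pos
    refine le_trans (ENNReal.ofReal_le_ofReal ?_) (le_pathLen_of_disjoint_layerHoles
      (m := 20 * n) (by omega) hγ (twenty_mul_le_sq le_rfl) ?_ hK)
    · have h1 : (1 : ℝ) ≤ n := by exact_mod_cast hn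
      rw [Nat.cast_sub (by omega)]
      push_cast
      rw [le_div_iff₀ (by positivity)]
      nlinarith
    · intro j hj l hl
      have hi : l + 20 * n * j < 20 * n * (20 * n ^ 2) := by
        calc l + 20 * n * j < 20 * n + 20 * n * j := by omega
          _ = 20 * n * (j + 1) := by ring
          _ ≤ 20 * n * (20 * n ^ 2) := Nat.mul_le_mul_left _ hj
      have := hP (l + 20 * n * j) (hi.trans_le hnh)
      rwa [nestedHole, if_pos hi, Nat.add_mul_mod_self_left, Nat.mod_eq_of_lt hl,
        Nat.add_mul_div_left _ _ (by omega), Nat.div_eq_of_lt hl, zero_add] at this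

/-- There is an absolute constant `c > 0` such that for every `h ≥ 1` there is
a polygonal domain `P ∈ 𝒞(h)` and points `s, t ∈ P` such that every continuous path from `s`
to `t` inside `P` has length at least `c·h^{1/3}·diam₂(P)`. -/
theorem geodesic_diameter_lower_bound :
    ∃ c : ℝ, 0 < c ∧
      ∀ h : ℕ, 1 ≤ h →
        ∃ (P₀ : Set Plane) (Q : Fin h → Set Plane),
          IsConvexPolygon P₀ ∧
          (∀ i, IsConvexPolygon (Q i)) ∧
          Pairwise (Function.onFun Disjoint Q) ∧
          (∀ i, Q i ⊆ interior P₀) ∧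
          ∃ s ∈ (P₀ \ ⋃ i, interior (Q i)), ∃ t ∈ (P₀ \ ⋃ i, interior (Q i)),
            ∀ γ : ℝ → Plane, IsPathIn (P₀ \ ⋃ i, interior (Q i)) γ s t →
              ENNReal.ofReal
                  (c * (h : ℝ) ^ ((1 : ℝ) / 3) *
                    Metric.diam (P₀ \ ⋃ i, interior (Q i))) ≤ pathLen γ := by
  refine ⟨1 / 400, by norm_num, fun h hh => ?_⟩
  obtain ⟨z, hz⟩ : ∃ z : ℝ, z = (h : ℝ) ^ ((1 : ℝ) / 3) := ⟨_, rfl⟩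
  have hz0 : 0 ≤ z := hz ▸ by positivity
  have hz3 : z ^ 3 = h := by
    rw [hz, ← Real.rpow_natCast, ← Real.rpow_mul (by positivity)]
    norm_num
  obtain ⟨n, hn₁, hn₂⟩ : ∃ n : ℕ, 8 * (n : ℝ) ≤ z ∧ z < 8 * (n + 1) := by
    have h₁ := Nat.floor_le (show 0 ≤ z / 8 by positivity)
    have h₂ := Nat.lt_floor_add_one (z / 8)
    exact ⟨⌊z / 8⌋₊, by linarith, by linarith⟩
  have hnh : 20 * n * (20 * n ^ 2) ≤ h := by
    have h₁ : (8 * (n : ℝ)) ^ 3 ≤ z ^ 3 := by gcongr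
    rw [hz3] at h₁
    have h₂ : (8 * n) ^ 3 ≤ h := by exact_mod_cast h₁
    calc 20 * n * (20 * n ^ 2) = 400 * n ^ 3 := by ring
      _ ≤ 512 * n ^ 3 := by gcongr; norm_num
      _ = (8 * n) ^ 3 := by ring
      _ ≤ h := h₂
  rw [← hz]
  set P : Set Plane :=
    rotatedRect 0 (-5) 5 5 \ ⋃ i : Fin h, interior (nestedHole n i) with hPdef
  have hmem : ∀ x : Plane, ‖x‖ < 5 → (‖x‖ = 0 ∨ 3 ≤ ‖x‖) → x ∈ P := by
    intro x hx hx'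
    refine ⟨interior_subset (mem_interior_square_of_norm_lt hx), ?_⟩
    rw [mem_iUnion]
    rintro ⟨i, hi⟩
    have := norm_of_mem_interior_nestedHole hi
    rcases hx' with h' | h' <;> linarith
  refine ⟨rotatedRect 0 (-5) 5 5, fun i : Fin h => nestedHole n i,
    isConvexPolygon_rotatedRect (by norm_num) (by norm_num),
    fun i => isConvexPolygon_nestedHole n i, ?_,
    fun i x hx => mem_interior_square_of_norm_lt (norm_lt_five_of_mem_nestedHole hx),
    0, hmem 0 (by simp) (by simp), polarPoint 4 0,
    hmem _ (by rw [norm_polarPoint] <;> norm_num) (by rw [norm_polarPoint] <;> norm_num), ?_⟩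
  · intro i j hij
    rcases lt_or_gt_of_ne hij with h' | h'
    · exact disjoint_nestedHole h'
    · exact (disjoint_nestedHole h').symm
  · intro γ hγ
    refine le_trans (ENNReal.ofReal_le_ofReal ?_)
      (le_pathLen_of_disjoint_nestedHoles hnh (fun i hi => ?_) hγ)
    · calc 1 / 400 * z * Metric.diam P ≤ 1 / 400 * z * 16 := by
            gcongr; exact diam_le_of_subset_square sdiff_subset
        _ ≤ 8 / 25 * (n + 1) := by linarith
    · exact Set.disjoint_sdiff_left.mono_right
        (subset_iUnion (fun i : Fin h => interior (nestedHole n i)) ⟨i, hi⟩)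
end
end

section
/- There is an absolute constant C > 0 such that for every natural number h, every polygonal domain P = P₀ \ ⋃_{i=1}^h interior(Pᵢ) in 𝒞(h), and every point s ∈ P, there exists a continuous path γ : [0,1] → ℝ² with γ(0) = s, γ(1) ∈ frontier(P₀), image of γ contained in P, and length at most C·(1 + √h)·diam₂(P). -/
open Set Metric ENNReal RealInnerProductSpace

noncomputable section

open MeasureTheory
open scoped Topology

/-- The linear functional `x ↦ x₀ + b x₁`. -/
def slant (b : ℝ) (x : Plane) : ℝ := x 0 + b * x 1

lemma isLinearMap_slant (b : ℝ) : IsLinearMap ℝ (slant b) where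
  map_add x y := by simp only [slant, PiLp.add_apply]; ring
  map_smul c x := by simp only [slant, PiLp.smul_apply, smul_eq_mul]; ring

lemma continuous_slant (b : ℝ) : Continuous (slant b) := by
  unfold slant; fun_prop

lemma norm_le_abs_add_abs (d : Plane) : ‖d‖ ≤ |d 0| + |d 1| := by
  rw [EuclideanSpace.norm_eq, Fin.sum_univ_two]
  refine Real.sqrt_le_iff.2 ⟨by positivity, ?_⟩
  simp only [Real.norm_eq_abs]
  nlinarith [abs_nonneg (d 0), abs_nonneg (d 1)]

lemma abs_sub_apply_le_dist (x y : Plane) (j : Fin 2) : |x j - y j| ≤ dist x y := by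
  rw [dist_eq_norm]
  simpa using PiLp.norm_apply_le (x - y) j

/-- The unit vector along the first axis. -/
def axis : Plane := !₂[1, 0]

lemma add_smul_axis_zero (q : Plane) (t : ℝ) : (q + t • axis) 0 = q 0 + t := by
  simp [axis]

lemma add_smul_axis_one (q : Plane) (t : ℝ) : (q + t • axis) 1 = q 1 := by
  simp [axis]

lemma slant_add_smul_axis (b : ℝ) (q : Plane) (t : ℝ) :
    slant b (q + t • axis) = slant b q + t := by
  simp only [slant, add_smul_axis_zero, add_smul_axis_one]; ring

lemma continuous_add_smul_axis (q : Plane) : Continuous fun t : ℝ => q + t • axis := by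
  fun_prop

lemma exists_add_smul_axis_mem {Q : Set Plane} {q : Plane} (hq : q ∈ interior Q) :
    ∃ t : ℝ, 0 < t ∧ q + t • axis ∈ Q ∧ q + (-t) • axis ∈ Q := by
  have h0 : ∀ᶠ t : ℝ in 𝓝 0, q + t • axis ∈ Q := by
    refine (continuous_add_smul_axis q).continuousAt.eventually_mem ?_
    simpa using mem_interior_iff_mem_nhds.1 hq
  obtain ⟨ε, hε, h⟩ := Metric.eventually_nhds_iff.1 h0
  have hd : dist (ε / 2) 0 < ε := by
    rw [Real.dist_eq, sub_zero, abs_of_pos (by linarith)]; linarith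
  refine ⟨ε / 2, by linarith, h hd, h ?_⟩
  rwa [Real.dist_eq, sub_zero, abs_neg, ← sub_zero (ε / 2), ← Real.dist_eq]

lemma IsMinOn.notMem_interior_of_slant {b : ℝ} {Q : Set Plane} {q : Plane}
    (h : IsMinOn (slant b) Q q) : q ∉ interior Q := by
  intro hq
  obtain ⟨t, ht, -, hm⟩ := exists_add_smul_axis_mem hq
  have := isMinOn_iff.1 h _ hm
  rw [slant_add_smul_axis] at this
  linarith

lemma IsMaxOn.notMem_interior_of_slant {b : ℝ} {Q : Set Plane} {q : Plane}
    (h : IsMaxOn (slant b) Q q) : q ∉ interior Q := by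
  intro hq
  obtain ⟨t, ht, hm, -⟩ := exists_add_smul_axis_mem hq
  have := isMaxOn_iff.1 h _ hm
  rw [slant_add_smul_axis] at this
  linarith

lemma le_slant_of_mem_convexHull {b c : ℝ} {S : Set Plane} (h : ∀ x ∈ S, c ≤ slant b x)
    {x : Plane} (hx : x ∈ convexHull ℝ S) : c ≤ slant b x :=
  convexHull_min (t := {x | c ≤ slant b x}) h
    (convex_halfSpace_ge (isLinearMap_slant b) c) hx

/-- The second coordinates of minimizers of `slant b` decrease with `b`. -/
lemma apply_one_le_of_isMinOn {b c : ℝ} (hbc : b < c) {Q : Set Plane} {x y : Plane}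
    (hx : x ∈ Q) (hy : y ∈ Q) (hxm : IsMinOn (slant b) Q x) (hym : IsMinOn (slant c) Q y) :
    y 1 ≤ x 1 := by
  have h1 := isMinOn_iff.1 hxm y hy
  have h2 := isMinOn_iff.1 hym x hx
  simp only [slant] at h1 h2
  nlinarith

/-- A point of a polygon at which a functional that is injective on the vertices attains the same
minimum as at a vertex is that vertex. -/
lemma eq_of_slant_eq {a : ℝ} {S : Set Plane} (hinj : Set.InjOn (slant a) S) {w q : Plane}
    (hw : w ∈ S) (hmin : IsMinOn (slant a) S w) (hq : q ∈ convexHull ℝ S)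
    (h : slant a q = slant a w) : q = w := by
  have hsub : convexHull ℝ S ⊆ {x | x = w ∨ slant a w < slant a x} := by
    refine convexHull_min (fun x hx => ?_) ?_
    · rcases (isMinOn_iff.1 hmin x hx).eq_or_lt with h | h
      · exact Or.inl (hinj hx hw h.symm)
      · exact Or.inr h
    · intro x hx y hy s t hs ht hst
      rcases hs.eq_or_lt with rfl | hs
      · obtain rfl : t = 1 := by linarith
        simpa using hy
      rcases ht.eq_or_lt with rfl | ht
      · obtain rfl : s = 1 := by linarith
        simpa using hx
      have hlin : slant a (s • x + t • y) = s * slant a x + t * slant a y := by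
        rw [(isLinearMap_slant a).map_add, (isLinearMap_slant a).map_smul,
          (isLinearMap_slant a).map_smul, smul_eq_mul, smul_eq_mul]
      have hw' : slant a w = s * slant a w + t * slant a w := by rw [← add_mul, hst, one_mul]
      rcases hx with rfl | hx <;> rcases hy with rfl | hy
      · left; rw [← add_smul, hst, one_smul]
      · right; rw [hlin]; nlinarith
      · right; rw [hlin]; nlinarith
      · right; rw [hlin]; nlinarith
  rcases hsub hq with h' | h'
  · exact h'
  · exact absurd h h'.ne'

/-- Rotating a supporting line of a polygon about a boundary point until it hits a vertex on the
side prescribed by the sign `σ`. -/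
lemma exists_rotated_support {σ : ℝ} (hσ : σ = 1 ∨ σ = -1) {S : Finset Plane} {q : Plane}
    {b₀ : ℝ} (hb₀ : ∀ x ∈ S, slant b₀ q ≤ slant b₀ x)
    (hex : ∃ x ∈ S, σ * q 1 < σ * x 1) :
    ∃ b, σ * b ≤ σ * b₀ ∧ (∀ x ∈ S, slant b q ≤ slant b x) ∧
      ∃ w ∈ S, σ * q 1 < σ * w 1 ∧ slant b w = slant b q := by
  classical
  have hne : (S.filter fun x => σ * q 1 < σ * x 1).Nonempty := by
    obtain ⟨x, hx, hxq⟩ := hex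
    exact ⟨x, Finset.mem_filter.2 ⟨hx, hxq⟩⟩
  obtain ⟨w, hw, hmax⟩ := Finset.exists_max_image _
    (fun x : Plane => -(x 0 - q 0) / (σ * x 1 - σ * q 1)) hne
  obtain ⟨hwS, hwq⟩ := Finset.mem_filter.1 hw
  have hσσ : σ * σ = 1 := by rcases hσ with rfl | rfl <;> norm_num
  set m := -(w 0 - q 0) / (σ * w 1 - σ * q 1) with hm
  have hmw : m * (σ * w 1 - σ * q 1) = -(w 0 - q 0) :=
    div_mul_cancel₀ _ (by linarith)
  have hle : m ≤ σ * b₀ := by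
    rw [hm, div_le_iff₀ (by linarith)]
    have := hb₀ w hwS
    simp only [slant] at this
    linear_combination this - (b₀ * w 1 - b₀ * q 1) * hσσ
  clear_value m
  refine ⟨σ * m, by linear_combination hle + m * hσσ, fun x hx => ?_, w, hwS, hwq, ?_⟩
  · simp only [slant]
    rcases lt_or_ge (σ * q 1) (σ * x 1) with hxq | hxq
    · have := hmax x (Finset.mem_filter.2 ⟨hx, hxq⟩)
      rw [div_le_iff₀ (by linarith)] at this
      linarith
    · have h0 := hb₀ x hx
      simp only [slant] at h0
      have h1 : 0 ≤ (σ * b₀ - m) * (σ * q 1 - σ * x 1) :=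
        mul_nonneg (by linarith) (by linarith)
      linear_combination h0 + h1 + (b₀ * q 1 - b₀ * x 1) * hσσ
  · simp only [slant]
    linear_combination hmw

/-- A boundary point of a polygon behind which (along the axis) lies the interior
can be left along the boundary so that a generic functional increases up to the next vertex. -/
lemma exists_edge {a : ℝ} {S : Finset Plane} (hinj : Set.InjOn (slant a) (S : Set Plane))
    {q : Plane} (hq : q ∈ convexHull ℝ (S : Set Plane))
    (hqi : q ∉ interior (convexHull ℝ (S : Set Plane))) {ε : ℝ} (hε : 0 < ε)
    (hε' : q + ε • axis ∈ interior (convexHull ℝ (S : Set Plane))) :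
    ∃ b, ∃ w ∈ S, slant a q < slant a w ∧ slant b w = slant b q ∧
      IsMinOn (slant b) (convexHull ℝ (S : Set Plane)) q := by
  set Q := convexHull ℝ (S : Set Plane) with hQ
  have hconv : Convex ℝ Q := convex_convexHull ℝ _
  obtain ⟨f, hf⟩ := geometric_hahn_banach_open_point hconv.interior isOpen_interior hqi
  have hfQ : ∀ x ∈ Q, f x ≤ f q := by
    have hcl : Q ⊆ closure (interior Q) := by
      rw [hconv.closure_interior_eq_closure_of_nonempty_interior ⟨_, hε'⟩]
      exact subset_closure
    intro x hx
    exact closure_minimal (fun y hy => (hf y hy).le)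
      (isClosed_le f.continuous continuous_const) (hcl hx)
  have hfa : f axis < 0 := by
    have := hf _ hε'
    rw [map_add, map_smul, smul_eq_mul] at this
    nlinarith
  obtain ⟨b₀, hb₀⟩ : ∃ b₀, ∀ x, f x = f axis * slant b₀ x := by
    refine ⟨f !₂[0, 1] / f axis, fun x => ?_⟩
    have hx : x = x 0 • axis + x 1 • !₂[0, 1] := by
      ext j; fin_cases j <;> simp [axis]
    conv_lhs => rw [hx]
    rw [map_add, map_smul, map_smul, smul_eq_mul, smul_eq_mul, slant]
    have := hfa.ne
    field_simp
  have hmin₀ : ∀ x ∈ S, slant b₀ q ≤ slant b₀ x := by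
    intro x hx
    have := hfQ x (subset_convexHull ℝ _ hx)
    rw [hb₀ x, hb₀ q] at this
    exact (mul_le_mul_left_of_neg hfa).1 this
  have hex : ∀ σ : ℝ, (σ = 1 ∨ σ = -1) → ∃ x ∈ S, σ * q 1 < σ * x 1 := by
    intro σ hσ
    by_contra! hcon
    have hlin : IsLinearMap ℝ fun x : Plane => σ * x 1 :=
      ⟨fun x y => by simp only [PiLp.add_apply]; ring,
        fun c x => by simp only [PiLp.smul_apply, smul_eq_mul]; ring⟩
    have hall : ∀ x ∈ Q, σ * x 1 ≤ σ * q 1 := fun x hx =>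
      convexHull_min (t := {x : Plane | σ * x 1 ≤ σ * q 1}) hcon
        (convex_halfSpace_le hlin _) hx
    have h0 : ∀ᶠ t : ℝ in 𝓝 0, (q + ε • axis) + t • (!₂[0, σ] : Plane) ∈ Q := by
      have hc : Continuous fun t : ℝ => (q + ε • axis) + t • (!₂[0, σ] : Plane) := by fun_prop
      refine hc.continuousAt.eventually_mem ?_
      simpa using mem_interior_iff_mem_nhds.1 hε'
    obtain ⟨t, ht, ht0⟩ := ((h0.filter_mono nhdsWithin_le_nhds).and
      (self_mem_nhdsWithin (s := Set.Ioi (0 : ℝ)))).exists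
    have := hall _ ht
    have hσσ : σ * σ = 1 := by rcases hσ with rfl | rfl <;> norm_num
    simp [axis] at this ht0
    nlinarith
  have key : ∃ b, ∃ w ∈ S, slant a q ≤ slant a w ∧ w ≠ q ∧ slant b w = slant b q ∧
      ∀ x ∈ S, slant b q ≤ slant b x := by
    rcases le_total b₀ a with hab | hab
    · obtain ⟨b, hb, hbS, w, hw, hqw, hbw⟩ :=
        exists_rotated_support (Or.inl rfl) hmin₀ (hex 1 (Or.inl rfl))
      refine ⟨b, w, hw, ?_, ?_, hbw, hbS⟩
      · simp only [slant] at hbw ⊢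
        nlinarith
      · rintro rfl; exact lt_irrefl _ hqw
    · obtain ⟨b, hb, hbS, w, hw, hqw, hbw⟩ :=
        exists_rotated_support (Or.inr rfl) hmin₀ (hex (-1) (Or.inr rfl))
      refine ⟨b, w, hw, ?_, ?_, hbw, hbS⟩
      · simp only [slant] at hbw ⊢
        nlinarith
      · rintro rfl; exact lt_irrefl _ hqw
  obtain ⟨b, w, hw, haw, hwq, hbw, hbS⟩ := key
  refine ⟨b, w, hw, lt_of_le_of_ne haw fun heq => hwq ?_, hbw,
    isMinOn_iff.2 fun x hx => le_slant_of_mem_convexHull hbS hx⟩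
  have hab : (a - b) * (w 1 - q 1) = 0 := by
    simp only [slant] at hbw heq
    linarith
  rcases mul_eq_zero.1 hab with hab | h1
  · obtain rfl : a = b := by linarith
    refine (eq_of_slant_eq hinj hw (isMinOn_iff.2 fun x hx => ?_) hq hbw.symm).symm
    rw [hbw]
    exact hbS x hx
  · have h1' : w 1 = q 1 := by linarith
    simp only [slant, h1'] at hbw
    ext j
    fin_cases j
    · simpa using hbw
    · simpa using h1'

/-- `p` can be joined inside `P` to a point of `T` by a path of length at most `ℓ`. -/
def CanReach (P T : Set Plane) (p : Plane) (ℓ : ℝ) : Prop :=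
  ∃ γ : ℝ → Plane, ContinuousOn γ (Set.Icc 0 1) ∧ γ 0 = p ∧ γ 1 ∈ T ∧
    Set.MapsTo γ (Set.Icc 0 1) P ∧ pathLen γ ≤ ENNReal.ofReal ℓ

lemma CanReach.mono {P T : Set Plane} {p : Plane} {ℓ ℓ' : ℝ} (h : CanReach P T p ℓ)
    (hℓ : ℓ ≤ ℓ') : CanReach P T p ℓ' := by
  obtain ⟨γ, hc, h0, h1, hP, hl⟩ := h
  exact ⟨γ, hc, h0, h1, hP, hl.trans (ENNReal.ofReal_le_ofReal hℓ)⟩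

lemma CanReach.refl {P T : Set Plane} {p : Plane} (hP : p ∈ P) (hT : p ∈ T) :
    CanReach P T p 0 := by
  refine ⟨fun _ => p, continuousOn_const, rfl, hT, fun _ _ => hP, ?_⟩
  rw [pathLen, eVariationOn.constant_on]
  · exact zero_le
  · rintro _ ⟨x, -, rfl⟩ _ ⟨y, -, rfl⟩
    rfl

lemma eVariationOn_lineMap_le (p q : Plane) :
    eVariationOn (AffineMap.lineMap p q : ℝ → Plane) (Set.Icc 0 1)
      ≤ ENNReal.ofReal (dist p q) := by
  have h := (lipschitzWith_lineMap (𝕜 := ℝ) p q).lipschitzOnWith (s := Set.univ)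
    |>.comp_eVariationOn_le (g := (id : ℝ → ℝ)) (s := Set.Icc 0 1) (fun _ _ => Set.mem_univ _)
  rw [Function.comp_id] at h
  refine h.trans ?_
  have h1 : eVariationOn (id : ℝ → ℝ) (Set.Icc 0 1) ≤ 1 := by simp
  calc _ ≤ (nndist p q : ℝ≥0∞) * 1 := by gcongr
    _ = _ := by rw [mul_one, ← edist_nndist, edist_dist]

lemma CanReach.prepend {P T : Set Plane} {p q : Plane} {ℓ : ℝ} (hℓ : 0 ≤ ℓ)
    (hseg : segment ℝ p q ⊆ P) (h : CanReach P T q ℓ) : CanReach P T p (dist p q + ℓ) := by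
  obtain ⟨γ, hc, h0, h1, hP, hl⟩ := h
  set δ : ℝ → Plane := fun t =>
    if t ≤ 1 / 2 then AffineMap.lineMap p q (2 * t) else γ (2 * t - 1) with hδ
  have hδ₁ : Set.EqOn δ ((AffineMap.lineMap p q : ℝ → Plane) ∘ fun t => 2 * t)
      (Set.Icc 0 (1 / 2)) := fun t ht => if_pos ht.2
  have hδ₂ : Set.EqOn δ (γ ∘ fun t => 2 * t - 1) (Set.Icc (1 / 2) 1) := by
    intro t ht
    rcases ht.1.eq_or_lt with rfl | ht'
    · simp [hδ, h0]
    · exact if_neg ht'.not_ge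
  have hI : Set.Icc (0 : ℝ) 1 = Set.Icc 0 (1 / 2) ∪ Set.Icc (1 / 2) 1 :=
    (Set.Icc_union_Icc_eq_Icc (by norm_num) (by norm_num)).symm
  have hm₁ : Set.MapsTo (fun t : ℝ => 2 * t) (Set.Icc 0 (1 / 2)) (Set.Icc 0 1) :=
    fun t ht => ⟨by linarith [ht.1], by linarith [ht.2]⟩
  have hm₂ : Set.MapsTo (fun t : ℝ => 2 * t - 1) (Set.Icc (1 / 2) 1) (Set.Icc 0 1) :=
    fun t ht => ⟨by linarith [ht.1], by linarith [ht.2]⟩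
  refine ⟨δ, ?_, ?_, ?_, ?_, ?_⟩
  · rw [hI]
    refine ContinuousOn.union_of_isClosed ?_ ?_ isClosed_Icc isClosed_Icc
    · refine ContinuousOn.congr ?_ hδ₁
      exact (AffineMap.lineMap_continuous.comp (by fun_prop)).continuousOn
    · exact (hc.comp (by fun_prop) hm₂).congr hδ₂
  · simp [hδ]
  · rw [hδ₂ ⟨by norm_num, le_rfl⟩]
    norm_num [h1]
  · rw [hI]
    refine Set.MapsTo.union ?_ ?_
    · refine Set.MapsTo.congr (fun t ht => hseg ?_) hδ₁.symm
      rw [segment_eq_image_lineMap]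
      exact ⟨_, hm₁ ht, rfl⟩
    · exact (hP.comp hm₂).congr hδ₂.symm
  · rw [pathLen, hI, eVariationOn.union δ (isGreatest_Icc (by norm_num))
      (isLeast_Icc (by norm_num)),
      eVariationOn.eq_of_eqOn hδ₁, eVariationOn.eq_of_eqOn hδ₂,
      ENNReal.ofReal_add dist_nonneg hℓ]
    refine add_le_add ?_ ?_
    · refine (eVariationOn.comp_le_of_monotoneOn _ _ ?_ hm₁).trans (eVariationOn_lineMap_le p q)
      intro x _ y _ hxy
      simpa using hxy
    · refine (eVariationOn.comp_le_of_monotoneOn _ _ ?_ hm₂).trans hl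
      intro x _ y _ hxy
      simpa using hxy

/-- From every point of a domain with finitely many holes one can move along the axis until the
outer boundary or the boundary of a hole whose interior lies ahead. -/
lemma exists_axis_exit {ι : Type*} [Finite ι] {P₀ : Set Plane} {Q : ι → Set Plane}
    (hP₀ : IsCompact P₀) (hQ : ∀ i, IsClosed (Q i)) {p : Plane}
    (hp : p ∈ P₀ \ ⋃ i, interior (Q i)) :
    ∃ T : ℝ, 0 ≤ T ∧ (∀ τ ∈ Set.Icc 0 T, p + τ • axis ∈ P₀ \ ⋃ i, interior (Q i)) ∧
      (p + T • axis ∈ frontier P₀ ∨ ∃ i, p + T • axis ∈ Q i ∧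
        ∃ ε : ℝ, 0 < ε ∧ p + T • axis + ε • axis ∈ interior (Q i)) := by
  set P := P₀ \ ⋃ i, interior (Q i) with hPdef
  have hPcl : IsClosed P := hP₀.isClosed.sdiff (isOpen_iUnion fun i => isOpen_interior)
  have hcont := continuous_add_smul_axis p
  set N : Set ℝ := {t | 0 ≤ t ∧ p + t • axis ∉ P} with hN
  have hNne : N.Nonempty := by
    obtain ⟨M, hM⟩ := (hP₀.image (continuous_slant 0)).bddAbove
    have hpM : slant 0 p ≤ M := hM ⟨p, hp.1, rfl⟩
    refine ⟨M - slant 0 p + 1, by linarith, fun hmem => ?_⟩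
    have := hM ⟨_, hmem.1, rfl⟩
    rw [slant_add_smul_axis] at this
    linarith
  have hNb : BddBelow N := ⟨0, fun t ht => ht.1⟩
  set T := sInf N with hT
  have hT0 : 0 ≤ T := le_csInf hNne fun t ht => ht.1
  have hlt : ∀ τ ∈ Set.Ico 0 T, p + τ • axis ∈ P := by
    intro τ hτ
    by_contra hcon
    exact notMem_of_lt_csInf hτ.2 hNb ⟨hτ.1, hcon⟩
  have hTP : p + T • axis ∈ P := by
    rcases hT0.eq_or_lt with h0 | h0
    · rw [← h0]; simpa using hp
    · have : T ∈ closure (Set.Ico 0 T) := by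
        rw [closure_Ico h0.ne]; exact Set.right_mem_Icc.2 h0.le
      exact closure_minimal (t := (fun t : ℝ => p + t • axis) ⁻¹' P) hlt
        (hPcl.preimage hcont) this
  refine ⟨T, hT0, fun τ hτ => ?_, ?_⟩
  · rcases hτ.2.eq_or_lt with h | h
    · rwa [h]
    · exact hlt τ ⟨hτ.1, h⟩
  by_cases hfr : p + T • axis ∈ frontier P₀
  · exact Or.inl hfr
  right
  have hmem_int : p + T • axis ∈ interior P₀ := by
    by_contra hcon
    exact hfr ⟨subset_closure hTP.1, hcon⟩
  have hfreq : ∃ᶠ t in 𝓝[>] T, p + t • axis ∉ P := by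
    intro hev
    obtain ⟨u, hu, hsub⟩ := mem_nhdsGT_iff_exists_Ioo_subset.1 hev
    obtain ⟨t, htN, htu⟩ := exists_lt_of_csInf_lt hNne (show sInf N < u from hu)
    have hTt : T < t := (csInf_le hNb htN).lt_of_ne fun h => htN.2 (h ▸ hTP)
    exact hsub ⟨hTt, htu⟩ htN.2
  have hev : ∀ᶠ t in 𝓝[>] T, p + t • axis ∈ P₀ :=
    (hcont.continuousAt.eventually_mem (mem_interior_iff_mem_nhds.1 hmem_int)).filter_mono
      nhdsWithin_le_nhds
  obtain ⟨i, hi⟩ : ∃ i, ∃ᶠ t in 𝓝[>] T, p + t • axis ∈ interior (Q i) := by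
    by_contra! hcon
    have hall : ∀ᶠ t in 𝓝[>] T, ∀ i, p + t • axis ∉ interior (Q i) :=
      Filter.eventually_all.2 fun i => hcon i
    refine hfreq ((hev.and hall).mono fun t ht => not_not.2 ⟨ht.1, ?_⟩)
    simpa using ht.2
  refine ⟨i, ?_, ?_⟩
  · by_contra hcon
    have : ∀ᶠ t in 𝓝[>] T, p + t • axis ∈ (Q i)ᶜ :=
      (hcont.continuousAt.eventually_mem ((hQ i).isOpen_compl.mem_nhds hcon)).filter_mono
        nhdsWithin_le_nhds
    obtain ⟨t, ht, ht'⟩ := (hi.and_eventually this).exists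
    exact ht' (interior_subset ht)
  · obtain ⟨t, ht, ht'⟩ := (hi.and_eventually self_mem_nhdsWithin).exists
    refine ⟨t - T, sub_pos.2 ht', ?_⟩
    rwa [add_assoc, ← add_smul, add_sub_cancel]

/-- The second coordinates of the points of `Q` above level `t` of `slant a` that minimize
`slant b` on `Q` for some `b ∈ I`. -/
def flatHeights (Q : Set Plane) (I : Set ℝ) (a t : ℝ) : Set ℝ :=
  {y | ∃ q ∈ Q, q 1 = y ∧ t ≤ slant a q ∧ ∃ b ∈ I, IsMinOn (slant b) Q q}

lemma flatHeights_anti (Q : Set Plane) (I : Set ℝ) (a : ℝ) {t t' : ℝ} (h : t ≤ t') :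
    flatHeights Q I a t' ⊆ flatHeights Q I a t := by
  rintro y ⟨q, hq, hy, ht, hb⟩
  exact ⟨q, hq, hy, h.trans ht, hb⟩

lemma volume_flatHeights_ne_top {Q : Set Plane} (hQ : IsCompact Q) (I : Set ℝ) (a t : ℝ) :
    volume (flatHeights Q I a t) ≠ ∞ := by
  have hc : Continuous fun x : Plane => x 1 := by fun_prop
  refine measure_ne_top_of_subset ?_ (hQ.image hc).measure_lt_top.ne
  rintro y ⟨q, hq, hy, -⟩
  exact ⟨q, hq, hy⟩

lemma volume_flatHeights_add_le {Q : Set Plane} (hQ : IsCompact Q) (hconv : Convex ℝ Q)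
    {I : Set ℝ} {a b : ℝ} (hb : b ∈ I) {q w : Plane} (hq : q ∈ Q) (hw : w ∈ Q)
    (hmin : IsMinOn (slant b) Q q) (hbw : slant b w = slant b q)
    (haw : slant a q < slant a w) :
    volume.real (flatHeights Q I a (slant a w)) + |w 1 - q 1|
      ≤ volume.real (flatHeights Q I a (slant a q)) := by
  have hpt : ∀ y ∈ Set.Ioo (min (q 1) (w 1)) (max (q 1) (w 1)),
      ∃ x ∈ Q, x 1 = y ∧ slant a q ≤ slant a x ∧ slant a x < slant a w ∧
        IsMinOn (slant b) Q x := by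
    intro y hy
    have hne : w 1 - q 1 ≠ 0 := by
      intro h
      rw [sub_eq_zero.1 h] at hy
      simp at hy
    obtain ⟨τ, hτ0, hτ1, hτ⟩ : ∃ τ : ℝ, 0 ≤ τ ∧ τ < 1 ∧ q 1 + τ * (w 1 - q 1) = y := by
      refine ⟨(y - q 1) / (w 1 - q 1), ?_, ?_, by field_simp; ring⟩ <;>
      rcases lt_or_gt_of_ne hne with h | h
      · rw [min_eq_right (by linarith), max_eq_left (by linarith)] at hy
        exact div_nonneg_of_nonpos (by linarith [hy.2]) h.le
      · rw [min_eq_left (by linarith), max_eq_right (by linarith)] at hy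
        exact div_nonneg (by linarith [hy.1]) h.le
      · rw [min_eq_right (by linarith), max_eq_left (by linarith)] at hy
        rw [div_lt_one_of_neg h]; linarith [hy.1]
      · rw [min_eq_left (by linarith), max_eq_right (by linarith)] at hy
        rw [div_lt_one h]; linarith [hy.2]
    have hs : ∀ c, slant c (q + τ • (w - q)) = slant c q + τ * (slant c w - slant c q) := by
      intro c
      rw [(isLinearMap_slant c).map_add, (isLinearMap_slant c).map_smul,
        (isLinearMap_slant c).map_sub, smul_eq_mul]
    refine ⟨q + τ • (w - q), hconv.add_smul_sub_mem hq hw ⟨hτ0, hτ1.le⟩, by simpa using hτ,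
      ?_, ?_, ?_⟩
    · rw [hs]; nlinarith
    · rw [hs]; nlinarith
    · refine isMinOn_iff.2 fun x hx => ?_
      rw [hs, hbw, sub_self, mul_zero, add_zero]
      exact isMinOn_iff.1 hmin x hx
  have hdisj : Disjoint (flatHeights Q I a (slant a w))
      (Set.Ioo (min (q 1) (w 1)) (max (q 1) (w 1))) := by
    rw [Set.disjoint_left]
    rintro y ⟨q', hq', rfl, hwq', b', -, hmin'⟩ hy
    obtain ⟨x, hx, hxy, -, hxw, -⟩ := hpt _ hy
    have := isMinOn_iff.1 hmin' x hx
    simp only [slant, hxy] at this hxw hwq'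
    linarith
  have hsub : flatHeights Q I a (slant a w) ∪ Set.Ioo (min (q 1) (w 1)) (max (q 1) (w 1))
      ⊆ flatHeights Q I a (slant a q) := by
    refine Set.union_subset (flatHeights_anti Q I a haw.le) fun y hy => ?_
    obtain ⟨x, hx, hxy, hqx, -, hxm⟩ := hpt y hy
    exact ⟨x, hx, hxy, hqx, b, hb, hxm⟩
  have hvol : volume.real (Set.Ioo (min (q 1) (w 1)) (max (q 1) (w 1))) = |w 1 - q 1| := by
    rw [Real.volume_real_Ioo_of_le min_le_max, max_sub_min_eq_abs]
  rw [← hvol, ← measureReal_union hdisj measurableSet_Ioo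
    (volume_flatHeights_ne_top hQ I a _) measure_Ioo_lt_top.ne]
  exact measureReal_mono hsub (volume_flatHeights_ne_top hQ I a _)

lemma volume_flatHeights_le {Q : Set Plane} {l u : ℝ} (hlu : l < u) {x y : Plane} (hx : x ∈ Q)
    (hy : y ∈ Q) (hxm : IsMinOn (slant l) Q x) (hym : IsMinOn (slant u) Q y) (a t : ℝ) :
    volume.real (flatHeights Q (Set.Ioo l u) a t) ≤ x 1 - y 1 := by
  have hsub : flatHeights Q (Set.Ioo l u) a t ⊆ Set.Icc (y 1) (x 1) := by
    rintro _ ⟨q, hq, rfl, -, b, hb, hqm⟩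
    exact ⟨apply_one_le_of_isMinOn hb.2 hq hy hqm hym,
      apply_one_le_of_isMinOn hb.1 hx hq hxm hqm⟩
  refine (measureReal_mono hsub measure_Icc_lt_top.ne).trans_eq ?_
  exact Real.volume_real_Icc_of_le (apply_one_le_of_isMinOn hlu hx hy hxm hym)

/-- A functional with a suitable slant in a given interval is injective on a given finite set. -/
lemma exists_slant_injOn (V : Finset Plane) {l u : ℝ} (hlu : l < u) :
    ∃ a ∈ Set.Ioo l u, Set.InjOn (slant a) (V : Set Plane) := by
  classical
  obtain ⟨a, ha, haF⟩ := (Set.Ioo_infinite hlu).exists_notMem_finset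
    ((V ×ˢ V).image fun z : Plane × Plane => -(z.1 0 - z.2 0) / (z.1 1 - z.2 1))
  refine ⟨a, ha, fun x hx y hy hxy => ?_⟩
  simp only [slant] at hxy
  have h1 : x 1 = y 1 := by
    by_contra hne
    refine haF (Finset.mem_image.2 ⟨(x, y), Finset.mem_product.2 ⟨hx, hy⟩, ?_⟩)
    rw [div_eq_iff (sub_ne_zero.2 hne)]
    linarith
  rw [h1] at hxy
  ext j
  fin_cases j
  · simpa using hxy
  · exact h1

/-- The length of an edge along which `slant b` is constant, for `b` away from `a`, is controlled by
the increase of `slant a`. -/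
lemma dist_le_of_slant_eq {a b η : ℝ} (ha : |a| ≤ 1) (hη : 0 < η) (hab : η ≤ |a - b|)
    {q w : Plane} (hbw : slant b w = slant b q) (haw : slant a q ≤ slant a w) :
    dist q w ≤ (1 + 2 / η) * (slant a w - slant a q) := by
  set g := slant a w - slant a q with hg
  have hg0 : 0 ≤ g := sub_nonneg.2 haw
  have hgd : g = (a - b) * (w 1 - q 1) := by
    simp only [slant] at hbw hg
    linear_combination hg + hbw
  have h1 : |w 1 - q 1| ≤ g / η := by
    rw [le_div_iff₀ hη, ← abs_of_nonneg hg0, hgd, abs_mul, mul_comm]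
    exact mul_le_mul_of_nonneg_right hab (abs_nonneg _)
  have h0 : |w 0 - q 0| ≤ g + g / η := by
    have : w 0 - q 0 = g - a * (w 1 - q 1) := by
      simp only [slant] at hg; linear_combination -hg
    rw [this]
    refine (abs_sub _ _).trans ?_
    rw [abs_of_nonneg hg0, abs_mul]
    nlinarith [abs_nonneg (w 1 - q 1), abs_nonneg a]
  rw [dist_comm, dist_eq_norm]
  refine (norm_le_abs_add_abs _).trans ?_
  simp only [PiLp.sub_apply]
  calc _ ≤ (g + g / η) + g / η := add_le_add h0 h1
    _ = _ := by ring

/-- The length of an edge along which `slant b` is constant is controlled by the change of the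
second coordinate. -/
lemma dist_le_two_mul_of_slant_eq {b : ℝ} (hb : |b| ≤ 1) {q w : Plane}
    (hbw : slant b w = slant b q) : dist q w ≤ 2 * |w 1 - q 1| := by
  rw [dist_comm, dist_eq_norm]
  refine (norm_le_abs_add_abs _).trans ?_
  simp only [PiLp.sub_apply]
  have : w 0 - q 0 = -(b * (w 1 - q 1)) := by
    simp only [slant] at hbw; linear_combination hbw
  rw [this, abs_neg, abs_mul]
  nlinarith [abs_nonneg (w 1 - q 1), abs_nonneg b]

/-- A boundary point of one of the holes can be joined to the endpoint of its edge inside the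
domain. -/
lemma segment_subset_of_isMinOn {ι : Type*} {P₀ : Set Plane} {Q : ι → Set Plane}
    (hconv : ∀ i, Convex ℝ (Q i)) (hdisj : Pairwise (Function.onFun Disjoint Q))
    (hsub : ∀ i, Q i ⊆ interior P₀) {i : ι} {b : ℝ} {q w : Plane} (hq : q ∈ Q i) (hw : w ∈ Q i)
    (hmin : IsMinOn (slant b) (Q i) q) (hbw : slant b w = slant b q) :
    segment ℝ q w ⊆ P₀ \ ⋃ i, interior (Q i) := by
  intro x hx
  have hxQ : x ∈ Q i := (hconv i).segment_subset hq hw hx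
  refine ⟨interior_subset (hsub i hxQ), fun hmem => ?_⟩
  obtain ⟨j, hj⟩ := Set.mem_iUnion.1 hmem
  rcases eq_or_ne i j with rfl | hij
  · refine IsMinOn.notMem_interior_of_slant (b := b) (isMinOn_iff.2 fun z hz => ?_) hj
    obtain ⟨s, t, -, -, hst, rfl⟩ := hx
    rw [(isLinearMap_slant b).map_add, (isLinearMap_slant b).map_smul,
      (isLinearMap_slant b).map_smul, hbw, ← add_smul, hst, one_smul]
    exact isMinOn_iff.1 hmin z hz
  · exact Set.disjoint_left.1 (hdisj hij) hxQ (interior_subset hj)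

/-- Following the axis in free space and hole boundaries in the direction in which `slant a`
increases, one reaches the outer boundary. -/
lemma canReach_frontier {ι : Type*} [Fintype ι] {P₀ : Set Plane} (hP₀ : IsCompact P₀)
    {S : ι → Finset Plane} {Q : ι → Set Plane} (hQ : ∀ i, Q i = convexHull ℝ (S i : Set Plane))
    (hdisj : Pairwise (Function.onFun Disjoint Q)) (hsub : ∀ i, Q i ⊆ interior P₀)
    {a l u η M : ℝ} (hl : 0 ≤ l) (hu : u ≤ 1) (hη : 0 < η) (hla : l + η ≤ a) (hau : a + η ≤ u)
    (hinj : ∀ i, Set.InjOn (slant a) (S i : Set Plane)) (hM : ∀ x ∈ P₀, slant a x ≤ M)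
    {p : Plane} (hp : p ∈ P₀ \ ⋃ i, interior (Q i)) :
    CanReach (P₀ \ ⋃ i, interior (Q i)) (frontier P₀) p
      ((1 + 2 / η) * (M - slant a p) +
        2 * ∑ i, volume.real (flatHeights (Q i) (Set.Ioo l u) a (slant a p))) := by
  classical
  have hQc : ∀ i, IsCompact (Q i) := fun i => by
    rw [hQ i]; exact (S i).finite_toSet.isCompact_convexHull ℝ
  have hconv : ∀ i, Convex ℝ (Q i) := fun i => by rw [hQ i]; exact convex_convexHull ℝ _
  have hc1 : 0 ≤ 2 / η := by positivity
  set R : ℝ → ℝ := fun t => ∑ i, volume.real (flatHeights (Q i) (Set.Ioo l u) a t) with hR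
  have hRnn : ∀ t, 0 ≤ R t := fun t => Finset.sum_nonneg fun i _ => measureReal_nonneg
  have hRanti : ∀ i, ∀ t t', t ≤ t' → volume.real (flatHeights (Q i) (Set.Ioo l u) a t') ≤
      volume.real (flatHeights (Q i) (Set.Ioo l u) a t) := fun i t t' h =>
    measureReal_mono (flatHeights_anti _ _ _ h) (volume_flatHeights_ne_top (hQc i) _ _ _)
  have hR_anti : ∀ t t', t ≤ t' → R t' ≤ R t := fun t t' h =>
    Finset.sum_le_sum fun i _ => hRanti i t t' h
  set V : Finset Plane := Finset.univ.biUnion S with hV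
  induction hn : (V.filter fun x => slant a p < slant a x).card using
    Nat.strong_induction_on generalizing p with
  | _ n ih =>
  obtain ⟨T, hT, hseg, hend⟩ := exists_axis_exit hP₀ (fun i => (hQc i).isClosed) hp
  set q := p + T • axis with hq
  have hqP := hseg T ⟨hT, le_rfl⟩
  have haq : slant a q = slant a p + T := slant_add_smul_axis _ _ _
  have hdpq : dist p q = T := by
    rw [dist_comm, dist_eq_norm, hq, add_sub_cancel_left, norm_smul, Real.norm_of_nonneg hT]
    simp [axis, EuclideanSpace.norm_eq]
  have hsegpq : segment ℝ p q ⊆ P₀ \ ⋃ i, interior (Q i) := by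
    rw [segment_eq_image']
    rintro _ ⟨θ, hθ, rfl⟩
    have := hseg (θ * T) ⟨mul_nonneg hθ.1 hT, mul_le_of_le_one_left hT hθ.2⟩
    simpa [hq, mul_smul] using this
  have hqM : slant a q ≤ M := hM q hqP.1
  rcases hend with hfr | ⟨i, hqi, ε, hε, hqε⟩
  · refine ((CanReach.refl hqP hfr).prepend le_rfl hsegpq).mono ?_
    rw [hdpq]
    have := hRnn (slant a p)
    nlinarith
  have hqint : q ∉ interior (Q i) := fun h => hqP.2 (Set.mem_iUnion.2 ⟨i, h⟩)
  obtain ⟨b, w, hw, haw, hbw, hmin⟩ : ∃ b, ∃ w ∈ S i, slant a q < slant a w ∧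
      slant b w = slant b q ∧ IsMinOn (slant b) (Q i) q := by
    rw [hQ i] at hqi hqint hqε ⊢
    exact exists_edge (hinj i) hqi hqint hε hqε
  have hwQ : w ∈ Q i := by rw [hQ i]; exact subset_convexHull ℝ _ hw
  have hsegqw := segment_subset_of_isMinOn hconv hdisj hsub hqi hwQ hmin hbw
  have hwP := hsegqw (right_mem_segment ℝ q w)
  have hcard : (V.filter fun x => slant a w < slant a x).card < n := by
    rw [← hn]
    refine Finset.card_lt_card (Finset.ssubset_iff_of_subset ?_ |>.2 ⟨w, ?_, ?_⟩)
    · exact Finset.monotone_filter_right _ fun x _ hx => by linarith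
    · exact Finset.mem_filter.2 ⟨Finset.mem_biUnion.2 ⟨i, Finset.mem_univ _, hw⟩, by linarith⟩
    · simp
  have hreach := ih _ hcard hwP rfl
  have hwM : slant a w ≤ M := hM w hwP.1
  have hstep : dist q w + 2 * R (slant a w) ≤
      (1 + 2 / η) * (slant a w - slant a q) + 2 * R (slant a q) := by
    by_cases hb : b ∈ Set.Ioo l u
    · have h1 := dist_le_two_mul_of_slant_eq (abs_le.2 ⟨by linarith [hb.1], by linarith [hb.2]⟩) hbw
      have h2 := volume_flatHeights_add_le (hQc i) (hconv i) hb hqi hwQ hmin hbw haw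
      have h3 : R (slant a w) + |w 1 - q 1| ≤ R (slant a q) := by
        simp only [hR]
        rw [← Finset.add_sum_erase _ _ (Finset.mem_univ i),
          ← Finset.add_sum_erase _ _ (Finset.mem_univ i)]
        have := Finset.sum_le_sum fun j (_ : j ∈ Finset.univ.erase i) => hRanti j _ _ haw.le
        linarith
      have h4 : 0 ≤ (1 + 2 / η) * (slant a w - slant a q) :=
        mul_nonneg (by linarith) (by linarith)
      linarith
    · have hab : η ≤ |a - b| := by
        rw [Set.mem_Ioo, not_and_or, not_lt, not_lt] at hb
        rcases hb with hb | hb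
        · exact le_trans (by linarith) (le_abs_self _)
        · exact le_trans (by linarith) (neg_le_abs _)
      have h1 := dist_le_of_slant_eq (abs_le.2 ⟨by linarith, by linarith⟩) hη hab hbw haw.le
      have h2 := hR_anti _ _ haw.le
      linarith
  have hnn : 0 ≤ (1 + 2 / η) * (M - slant a w) + 2 * R (slant a w) :=
    add_nonneg (mul_nonneg (by linarith) (by linarith)) (by linarith [hRnn (slant a w)])
  refine ((hreach.prepend hnn hsegqw).prepend (add_nonneg dist_nonneg hnn) hsegpq).mono ?_
  have h5 := hR_anti (slant a p) (slant a q) (by linarith)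
  rw [hdpq]
  have h6 : 0 ≤ 2 / η * T := mul_nonneg hc1 hT
  change T + (dist q w + ((1 + 2 / η) * (M - slant a w) + 2 * R (slant a w))) ≤
    (1 + 2 / η) * (M - slant a p) + 2 * R (slant a p)
  have h7 : T = slant a q - slant a p := by linarith
  rw [h7] at h6 ⊢
  linarith

/-- There is an absolute constant `C > 0` such that for every `h ∈ ℕ`, every
polygonal domain `P = P₀ \ ⋃ᵢ interior Pᵢ` in `𝒞(h)` and every `s ∈ P`, there is a continuous
path in `P` from `s` to the outer boundary `frontier P₀` of length at most
`C·(1 + √h)·diam₂(P)`. -/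
theorem escape_path_upper_bound :
    ∃ C : ℝ, 0 < C ∧
      ∀ (h : ℕ) (P₀ : Set Plane) (Q : Fin h → Set Plane),
        IsConvexPolygon P₀ →
        (∀ i, IsConvexPolygon (Q i)) →
        Pairwise (Function.onFun Disjoint Q) →
        (∀ i, Q i ⊆ interior P₀) →
        ∀ s ∈ (P₀ \ ⋃ i, interior (Q i)),
          ∃ γ : ℝ → Plane,
            ContinuousOn γ (Set.Icc 0 1) ∧ γ 0 = s ∧ γ 1 ∈ frontier P₀ ∧
            Set.MapsTo γ (Set.Icc 0 1) (P₀ \ ⋃ i, interior (Q i)) ∧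
            pathLen γ ≤
              ENNReal.ofReal
                (C * (1 + Real.sqrt h) * Metric.diam (P₀ \ ⋃ i, interior (Q i))) := by
  classical
  refine ⟨14, by norm_num, fun h P₀ Q hP₀ hQ hdisj hsub s hs => ?_⟩
  choose S hSne hQS using hQ
  have hP₀c : IsCompact P₀ := by
    obtain ⟨S₀, -, rfl⟩ := hP₀
    exact S₀.finite_toSet.isCompact_convexHull ℝ
  have hQc : ∀ i, IsCompact (Q i) := fun i => by
    rw [hQS i]; exact (S i).finite_toSet.isCompact_convexHull ℝ
  have hQne : ∀ i, (Q i).Nonempty := fun i => by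
    rw [hQS i]; exact (Finset.coe_nonempty.2 (hSne i)).convexHull
  have hconv : ∀ i, Convex ℝ (Q i) := fun i => by rw [hQS i]; exact convex_convexHull ℝ _
  set P := P₀ \ ⋃ i, interior (Q i) with hP
  have hPb : Bornology.IsBounded P := hP₀c.isBounded.subset Set.sdiff_subset
  set D := Metric.diam P with hD
  have hD0 : 0 ≤ D := Metric.diam_nonneg
  set K : ℕ := ⌊Real.sqrt h⌋₊ + 1 with hK
  have hK0 : (0 : ℝ) < K := by rw [hK]; positivity
  have hKl : Real.sqrt h ≤ K := by rw [hK]; push_cast; exact (Nat.lt_floor_add_one _).le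
  have hKu : (K : ℝ) ≤ Real.sqrt h + 1 := by
    rw [hK]; push_cast; linarith [Nat.floor_le (Real.sqrt_nonneg h)]
  choose m hmQ hmin using fun (i : Fin h) (k : ℕ) =>
    (hQc i).exists_isMinOn (hQne i) (continuous_slant ((k : ℝ) / K)).continuousOn
  have hmP : ∀ i k, m i k ∈ P := fun i k =>
    segment_subset_of_isMinOn hconv hdisj hsub (hmQ i k) (hmQ i k) (hmin i k) rfl
      (left_mem_segment ℝ _ _)
  obtain ⟨k, hk, hkle⟩ : ∃ k ∈ Finset.range K,
      ∑ i, (m i k 1 - m i (k + 1) 1) ≤ h * D / K := by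
    refine Finset.exists_le_of_sum_le ⟨0, by simp [hK]⟩ ?_
    rw [Finset.sum_comm, Finset.sum_const, Finset.card_range, nsmul_eq_mul,
      mul_div_cancel₀ _ hK0.ne']
    calc _ ≤ ∑ _i : Fin h, D := by
          refine Finset.sum_le_sum fun i _ => ?_
          rw [Finset.sum_range_sub' fun k => m i k 1]
          exact (le_abs_self _).trans ((abs_sub_apply_le_dist _ _ 1).trans
            (Metric.dist_le_diam_of_mem hPb (hmP i 0) (hmP i K)))
      _ = h * D := by simp
  have hkK : (k : ℝ) + 1 ≤ K := by exact_mod_cast Finset.mem_range.1 hk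
  set l : ℝ := k / K with hl
  set u : ℝ := (k + 1) / K with hu
  set η : ℝ := 1 / (3 * K) with hη
  have hη0 : 0 < η := by positivity
  have hlu : u = l + 3 * η := by rw [hl, hu, hη]; field_simp
  have hl0 : 0 ≤ l := by positivity
  have hu1 : u ≤ 1 := (div_le_one hK0).2 hkK
  obtain ⟨a, ha, hinj⟩ := exists_slant_injOn (Finset.univ.biUnion S)
    (show l + η < l + 2 * η by linarith)
  obtain ⟨z, hz, hzmax⟩ := hP₀c.exists_isMaxOn ⟨s, hs.1⟩ (continuous_slant a).continuousOn
  have hzP : z ∈ P := by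
    refine ⟨hz, fun hmem => hzmax.notMem_interior_of_slant ?_⟩
    obtain ⟨i, hi⟩ := Set.mem_iUnion.1 hmem
    exact hsub i (interior_subset hi)
  refine (canReach_frontier (M := slant a z) hP₀c hQS hdisj hsub hl0 hu1 hη0 ha.1.le
    (by linarith [ha.2]) (fun i => hinj.mono ?_) (fun x hx => isMaxOn_iff.1 hzmax x hx)
    hs).mono ?_
  · intro x hx
    exact Finset.mem_coe.2 (Finset.mem_biUnion.2 ⟨i, Finset.mem_univ _, hx⟩)
  have hR : ∑ i, volume.real (flatHeights (Q i) (Set.Ioo l u) a (slant a s)) ≤ h * D / K := by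
    refine (Finset.sum_le_sum fun i _ => ?_).trans hkle
    refine volume_flatHeights_le (by linarith) (hmQ i k) (hmQ i (k + 1)) (hmin i k) ?_ a _
    have := hmin i (k + 1)
    push_cast at this
    exact this
  have hRD : h * D / K ≤ Real.sqrt h * D := by
    rw [div_le_iff₀ hK0]
    calc (h : ℝ) * D = Real.sqrt h * D * Real.sqrt h := by
          rw [mul_right_comm, Real.mul_self_sqrt h.cast_nonneg]
      _ ≤ _ := by gcongr
  have hMs : slant a z - slant a s ≤ 2 * D := by
    have hdist := Metric.dist_le_diam_of_mem hPb hzP hs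
    have h0 := (abs_le.1 (abs_sub_apply_le_dist z s 0)).2
    have h1 := abs_sub_apply_le_dist z s 1
    have h2 : a * (z 1 - s 1) ≤ D := by
      refine (le_abs_self _).trans ?_
      rw [abs_mul, abs_of_nonneg (by linarith [ha.1])]
      exact (mul_le_of_le_one_left (abs_nonneg _) (by linarith [ha.2])).trans (h1.trans hdist)
    simp only [slant]
    linarith
  have hηK : 1 + 2 / η = 1 + 6 * K := by rw [hη]; field_simp; ring
  rw [hηK]
  have hsq := Real.sqrt_nonneg (h : ℝ)
  calc _ ≤ (1 + 6 * (K : ℝ)) * (2 * D) + 2 * (Real.sqrt h * D) := by gcongr; exact hR.trans hRD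
    _ ≤ (1 + 6 * (Real.sqrt h + 1)) * (2 * D) + 2 * (Real.sqrt h * D) := by gcongr
    _ = 14 * (1 + Real.sqrt h) * D := by ring
end
end
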